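/- arXiv:1807.07110 — 5 statements merged into one kernel-verified Lean document; each statement's English description precedes it below -/
import Mathlib

section
/- Let Λ be a finite lattice with least element ⊥ and greatest element ⊤, and let X be a set. The map Φ sending a Λ-ultrametric d on X to the family (E_λ)_{λ∈Λ}, where E_λ = {(x,y) ∈ X × X : d(x,y) ≤ λ}, is a bijection from the set of Λ-ultrametrics on X onto the set of maps L from Λ to the equivalence relations on X satisfying: L(λ ⊓ μ) = L(λ) ⊓ L(μ) for all λ, μ ∈ Λ, L(⊥) is the equality relation, and L(⊤) is the trivial (universal) relation. Its inverse sends such an L to the Λ-ultrametric d defined by d(x,y) = the meet of the (finite, nonempty) set {λ ∈ Λ : (x,y) ∈ L(λ)}. -/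
open scoped Classical

/-- A `Λ`-ultrametric on `X`: `d x y = ⊥` iff `x = y`, `d` is symmetric, and the triangle
inequality holds with join in place of addition. -/
def IsUltrametric {Λ X : Type*} [Lattice Λ] [OrderBot Λ] (d : X → X → Λ) : Prop :=
  (∀ x y, d x y = ⊥ ↔ x = y) ∧ (∀ x y, d x y = d y x) ∧
    (∀ x y z, d x z ≤ d x y ⊔ d y z)

/-- A family `L : Λ → (equivalence relations on X)` which is meet-preserving, sends `⊥` to
equality and `⊤` to the trivial (universal) relation. -/
def IsEqFamily {Λ X : Type*} [Lattice Λ] [BoundedOrder Λ] (L : Λ → X → X → Prop) : Prop :=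
  (∀ l, Equivalence (L l)) ∧
    (∀ a b x y, L (a ⊓ b) x y ↔ L a x y ∧ L b x y) ∧
    (∀ x y, L ⊥ x y ↔ x = y) ∧ (∀ x y : X, L ⊤ x y)

/-- The map `Φ` sending a `Λ`-ultrametric `d` to the family `λ ↦ {(x,y) : d x y ≤ λ}`. -/
def famOf {Λ X : Type*} [Lattice Λ] (d : X → X → Λ) : Λ → X → X → Prop :=
  fun l x y => d x y ≤ l

/-- The map sending a family `L` to `d(x,y) :=` the meet of the set `{λ : L λ x y}`. -/
noncomputable def distOf {Λ X : Type*} [Lattice Λ] [OrderTop Λ] [Fintype Λ]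
    (L : Λ → X → X → Prop) : X → X → Λ :=
  fun x y => (Finset.univ.filter (fun l => L l x y)).inf id

theorem distOf_le {Λ X : Type*} [Lattice Λ] [OrderTop Λ] [Fintype Λ]
    {L : Λ → X → X → Prop} {l : Λ} {x y : X} (h : L l x y) : distOf L x y ≤ l :=
  Finset.inf_le (f := id) (by simpa using h)

theorem distOf_famOf {Λ X : Type*} [Lattice Λ] [OrderTop Λ] [Fintype Λ] (d : X → X → Λ) :
    distOf (famOf d) = d := by
  funext x y
  refine le_antisymm (distOf_le (L := famOf d) (le_refl (d x y))) ?_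
  exact Finset.le_inf fun l hl => (Finset.mem_filter.mp hl).2

namespace IsEqFamily

variable {Λ X : Type*} [Lattice Λ] [BoundedOrder Λ] {L : Λ → X → X → Prop}

theorem mono (hL : IsEqFamily L) {a b : Λ} (hab : a ≤ b) {x y : X} (h : L a x y) : L b x y := by
  rw [← inf_eq_left.mpr hab] at h
  exact ((hL.2.1 a b x y).mp h).2

theorem rel_distOf [Fintype Λ] (hL : IsEqFamily L) (x y : X) : L (distOf L x y) x y :=
  Finset.inf_induction (p := fun l => L l x y) (hL.2.2.2 x y)
    (fun a ha b hb => (hL.2.1 a b x y).mpr ⟨ha, hb⟩)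
    (fun _ hl => (Finset.mem_filter.mp hl).2)

theorem distOf_le_iff [Fintype Λ] (hL : IsEqFamily L) {l : Λ} {x y : X} :
    distOf L x y ≤ l ↔ L l x y :=
  ⟨fun h => hL.mono h (hL.rel_distOf x y), distOf_le⟩

theorem famOf_distOf [Fintype Λ] (hL : IsEqFamily L) : famOf (distOf L) = L := by
  funext l x y
  exact propext hL.distOf_le_iff

theorem isUltrametric_distOf [Fintype Λ] (hL : IsEqFamily L) : IsUltrametric (distOf L) := by
  refine ⟨fun x y => ?_, fun x y => le_antisymm ?_ ?_, fun x y z => ?_⟩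
  · rw [← le_bot_iff, hL.distOf_le_iff, hL.2.2.1]
  · exact distOf_le ((hL.1 _).symm (hL.rel_distOf y x))
  · exact distOf_le ((hL.1 _).symm (hL.rel_distOf x y))
  · exact distOf_le ((hL.1 _).trans (hL.mono le_sup_left (hL.rel_distOf x y))
      (hL.mono le_sup_right (hL.rel_distOf y z)))

end IsEqFamily

theorem IsUltrametric.isEqFamily_famOf {Λ X : Type*} [Lattice Λ] [BoundedOrder Λ]
    {d : X → X → Λ} (hd : IsUltrametric d) : IsEqFamily (famOf d) := by
  obtain ⟨h0, hs, ht⟩ := hd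
  refine ⟨fun l => ⟨fun x => ?_, fun {x y} h => ?_, fun {x y z} h h' => ?_⟩,
    fun a b x y => le_inf_iff, fun x y => le_bot_iff.trans (h0 x y), fun x y => le_top⟩
  · exact ((h0 x x).mpr rfl).le.trans bot_le
  · exact (hs y x).le.trans h
  · exact (ht x y z).trans (sup_le h h')

/-- `famOf` is a bijection from the `Λ`-ultrametrics on `X` onto the admissible families of
equivalence relations, with inverse `distOf`. -/
theorem ultrametric_eqFamily_bijection {Λ X : Type*} [Lattice Λ] [BoundedOrder Λ] [Fintype Λ] :
    Set.BijOn (famOf : (X → X → Λ) → (Λ → X → X → Prop))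
      {d | IsUltrametric d} {L | IsEqFamily L} ∧
    Set.BijOn (distOf : (Λ → X → X → Prop) → (X → X → Λ))
      {L | IsEqFamily L} {d | IsUltrametric d} ∧
    (∀ d : X → X → Λ, IsUltrametric d → distOf (famOf d) = d) ∧
    (∀ L : Λ → X → X → Prop, IsEqFamily L → famOf (distOf L) = L) := by
  have left : Set.LeftInvOn distOf (famOf : (X → X → Λ) → _) {d | IsUltrametric d} :=
    fun d _ => distOf_famOf d
  have right : Set.LeftInvOn famOf (distOf : _ → X → X → Λ) {L | IsEqFamily L} :=
    fun _ hL => IsEqFamily.famOf_distOf hL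
  have maps : Set.MapsTo (famOf : (X → X → Λ) → _) {d | IsUltrametric d} {L | IsEqFamily L} :=
    fun _ hd => IsUltrametric.isEqFamily_famOf hd
  have maps' : Set.MapsTo (distOf : _ → X → X → Λ) {L | IsEqFamily L} {d | IsUltrametric d} :=
    fun _ hL => IsEqFamily.isUltrametric_distOf hL
  exact ⟨Set.InvOn.bijOn ⟨left, right⟩ maps maps', Set.InvOn.bijOn ⟨right, left⟩ maps' maps,
    fun _ hd => left hd, fun _ hL => right hL⟩
end

section
/- Let Λ be a finite lattice. The class of finite Λ-ultrametric spaces has the amalgamation property — i.e., for all finite Λ-ultrametric spaces A, B, C and isometric embeddings f : A → B and g : A → C, there exist a finite Λ-ultrametric space D and isometric embeddings h : B → D and k : C → D with h∘f = k∘g — if and only if Λ is distributive, i.e., x ⊓ (y ⊔ z) = (x ⊓ y) ⊔ (x ⊓ z) for all x, y, z ∈ Λ. -/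
/-- A finite `Λ`-ultrametric space. -/
structure UltraSpace (Λ : Type*) [Lattice Λ] [OrderBot Λ] where
  X : Type
  finite : Finite X
  d : X → X → Λ
  ultra : IsUltrametric d

/-- An isometric embedding of `Λ`-ultrametric spaces: an injective map preserving the metric. -/
structure UltraEmb {Λ : Type*} [Lattice Λ] [OrderBot Λ] (A B : UltraSpace Λ) where
  toFun : A.X → B.X
  inj : Function.Injective toFun
  dist_eq : ∀ x y, B.d (toFun x) (toFun y) = A.d x y

section Star

variable {Λ : Type*} [Lattice Λ] [OrderBot Λ]

/-- The star metric with weights `w`: distinct points `i` and `j` are at distance `w i ⊔ w j`. -/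
def starDist {I : Type*} [DecidableEq I] (w : I → Λ) (i j : I) : Λ :=
  if i = j then ⊥ else w i ⊔ w j

theorem isUltrametric_starDist {I : Type*} [DecidableEq I] (w : I → Λ)
    (hw : ∀ i j, w i = ⊥ → w j = ⊥ → i = j) : IsUltrametric (starDist w) := by
  refine ⟨fun i j => ?_, fun i j => ?_, fun i j k => ?_⟩
  · unfold starDist
    split_ifs with h
    · simp [h]
    · simp only [sup_eq_bot_iff, h, iff_false]
      exact fun ⟨hi, hj⟩ => h (hw i j hi hj)
  · simp only [starDist, eq_comm (a := i), sup_comm (w i)]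
  · by_cases hij : i = j
    · subst hij
      exact le_sup_right
    by_cases hjk : j = k
    · subst hjk
      exact le_sup_left
    by_cases hik : i = k
    · simp [starDist, hik]
    · simp only [starDist, hij, hjk, hik, if_false]
      exact sup_le_sup le_sup_left le_sup_right

/-- The finite star space on `n` points with weights `w`, at most one of which is `⊥`. -/
def starSpace {n : ℕ} (w : Fin n → Λ) (hw : ∀ i j, w i = ⊥ → w j = ⊥ → i = j) :
    UltraSpace Λ where
  X := Fin n
  finite := inferInstance
  d := starDist w
  ultra := isUltrametric_starDist w hw

theorem le_sup_inf_of_amalgamation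
    (hAP : ∀ (A B C : UltraSpace Λ) (f : UltraEmb A B) (g : UltraEmb A C),
      ∃ (D : UltraSpace Λ) (h : UltraEmb B D) (k : UltraEmb C D),
        ∀ a, h.toFun (f.toFun a) = k.toFun (g.toFun a))
    (x y z : Λ) : (x ⊔ y) ⊓ (x ⊔ z) ≤ x ⊔ y ⊓ z := by
  by_cases hx : x = ⊥
  · simp [hx]
  by_cases hy : y = ⊥
  · simp [hy]
  by_cases hz : z = ⊥
  · simp [hz]
  set u := (x ⊔ y) ⊓ (x ⊔ z) with hu
  have hxu : x ≤ u := le_inf le_sup_left le_sup_left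
  have hu0 : u ≠ ⊥ := fun h => hx (le_bot_iff.1 (h ▸ hxu))
  have hyu : y ⊔ u = y ⊔ x := le_antisymm
    (sup_le le_sup_left (inf_le_left.trans (sup_comm x y).le)) (sup_le_sup_left hxu y)
  have hzu : z ⊔ u = z ⊔ x := le_antisymm
    (sup_le le_sup_left (inf_le_right.trans (sup_comm x z).le)) (sup_le_sup_left hxu z)
  let A := starSpace ![y, z, x] (by intro i j; fin_cases i <;> fin_cases j <;> simp [hx, hy, hz])
  let B := starSpace ![⊥, y, z, x]
    (by intro i j; fin_cases i <;> fin_cases j <;> simp [hx, hy, hz])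
  let C := starSpace ![⊥, y, z, u]
    (by intro i j; fin_cases i <;> fin_cases j <;> simp [hu0, hy, hz])
  let f : UltraEmb A B :=
    { toFun := Fin.succ
      inj := Fin.succ_injective 3
      dist_eq := by
        intro (i : Fin 3) (j : Fin 3)
        simp [A, B, starSpace, starDist] }
  let g : UltraEmb A C :=
    { toFun := Fin.succ
      inj := Fin.succ_injective 3
      dist_eq := by
        intro (i : Fin 3) (j : Fin 3)
        fin_cases i <;> fin_cases j <;>
          simp [A, C, starSpace, starDist, hyu, hzu, sup_comm u, sup_comm x] }
  obtain ⟨D, h, k, hk⟩ := hAP A B C f g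
  have h_symm := D.ultra.2.1
  have h_tri := D.ultra.2.2
  let b : D.X := h.toFun (0 : Fin 4)
  let c : D.X := k.toFun (0 : Fin 4)
  let p (i : Fin 3) : D.X := h.toFun (Fin.succ i)
  have hp (i : Fin 3) : p i = k.toFun (Fin.succ i) := hk i
  have hb (i : Fin 3) : D.d b (p i) = ![y, z, x] i := by
    refine (h.dist_eq _ _).trans ?_
    simp [B, starSpace, starDist, (Fin.succ_ne_zero i).symm]
  have hc (i : Fin 3) : D.d c (p i) = ![y, z, u] i := by
    rw [hp]
    refine (k.dist_eq _ _).trans ?_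
    simp [C, starSpace, starDist, (Fin.succ_ne_zero i).symm]
  have hbc : D.d c b ≤ y ⊓ z := by
    refine le_inf ?_ ?_
    · simpa [h_symm (p 0) b, hb, hc] using h_tri c (p 0) b
    · simpa [h_symm (p 1) b, hb, hc] using h_tri c (p 1) b
  have key := h_tri c b (p 2)
  rw [hc, hb] at key
  exact key.trans (sup_le (hbc.trans le_sup_right) le_sup_left)

end Star

section Quotient

variable {Λ X : Type*} [Lattice Λ] [OrderBot Λ] (d : X → X → Λ)

/-- The relation `d x y = ⊥` of a pseudo-ultrametric, as a setoid. -/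
def distSetoid (h_self : ∀ x, d x x = ⊥) (h_symm : ∀ x y, d x y = d y x)
    (h_tri : ∀ x y z, d x z ≤ d x y ⊔ d y z) : Setoid X where
  r x y := d x y = ⊥
  iseqv :=
    { refl := h_self
      symm := fun {x y} h => (h_symm y x).trans h
      trans := fun {x y z} h h' => le_bot_iff.1 ((h_tri x y z).trans (by simp [h, h'])) }

theorem exists_isUltrametric_quotient (h_self : ∀ x, d x x = ⊥)
    (h_symm : ∀ x y, d x y = d y x) (h_tri : ∀ x y z, d x z ≤ d x y ⊔ d y z) :
    ∃ e : Quotient (distSetoid d h_self h_symm h_tri) →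
        Quotient (distSetoid d h_self h_symm h_tri) → Λ,
      IsUltrametric e ∧ ∀ x y, e (Quotient.mk _ x) (Quotient.mk _ y) = d x y := by
  have aux {x y x' y' : X} (hx : d x x' = ⊥) (hy : d y y' = ⊥) : d x y ≤ d x' y' := by
    refine (h_tri x x' y).trans (sup_le (by simp [hx]) ((h_tri x' y' y).trans ?_))
    simp [h_symm y' y, hy]
  refine ⟨Quotient.lift₂ d fun x y x' y' hx hy => le_antisymm (aux hx hy)
    (aux ((h_symm _ _).trans hx) ((h_symm _ _).trans hy)), ⟨?_, ?_, ?_⟩, fun _ _ => rfl⟩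
  · rintro ⟨x⟩ ⟨y⟩
    exact ⟨fun h => Quotient.sound h, fun h => Quotient.exact h⟩
  · rintro ⟨x⟩ ⟨y⟩
    exact h_symm x y
  · rintro ⟨x⟩ ⟨y⟩ ⟨z⟩
    exact h_tri x y z

end Quotient

section Amalgam

variable {Λ : Type*} [DistribLattice Λ] [BoundedOrder Λ] {A B C : UltraSpace Λ}

theorem UltraSpace.d_self (B : UltraSpace Λ) (b : B.X) : B.d b b = ⊥ :=
  (B.ultra.1 b b).2 rfl

/-- The distance between `b` and `c` through the common subspace `A`. -/
noncomputable def crossDist (f : UltraEmb A B) (g : UltraEmb A C) (b : B.X) (c : C.X) : Λ :=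
  letI := A.finite
  letI := Fintype.ofFinite A.X
  Finset.univ.inf fun a => B.d b (f.toFun a) ⊔ C.d (g.toFun a) c

theorem crossDist_le (f : UltraEmb A B) (g : UltraEmb A C) (b : B.X) (c : C.X) (a : A.X) :
    crossDist f g b c ≤ B.d b (f.toFun a) ⊔ C.d (g.toFun a) c :=
  let _ := A.finite
  let _ := Fintype.ofFinite A.X
  Finset.inf_le (Finset.mem_univ a)

theorem le_sup_crossDist (f : UltraEmb A B) (g : UltraEmb A C) (b : B.X) (c : C.X) (s t : Λ)
    (h : ∀ a, t ≤ s ⊔ (B.d b (f.toFun a) ⊔ C.d (g.toFun a) c)) :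
    t ≤ s ⊔ crossDist f g b c := by
  rw [crossDist, Finset.inf_sup_distrib_left]
  exact Finset.le_inf fun a _ => h a

theorem crossDist_swap (f : UltraEmb A B) (g : UltraEmb A C) (b : B.X) (c : C.X) :
    crossDist g f c b = crossDist f g b c := by
  unfold crossDist
  congr 1
  ext a
  rw [B.ultra.2.1, C.ultra.2.1, sup_comm]

theorem crossDist_le_left (f : UltraEmb A B) (g : UltraEmb A C) (b b' : B.X) (c : C.X) :
    crossDist f g b c ≤ B.d b b' ⊔ crossDist f g b' c := by
  refine le_sup_crossDist _ _ _ _ _ _ fun a => (crossDist_le f g b c a).trans ?_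
  rw [← sup_assoc]
  exact sup_le_sup_right (B.ultra.2.2 _ _ _) _

theorem dist_le_crossDist (f : UltraEmb A B) (g : UltraEmb A C) (b b' : B.X) (c : C.X) :
    B.d b b' ≤ crossDist f g b c ⊔ crossDist f g b' c := by
  refine le_sup_crossDist _ _ _ _ _ _ fun a' => ?_
  rw [sup_comm]
  refine le_sup_crossDist _ _ _ _ _ _ fun a => ?_
  have h_mid : B.d (f.toFun a) (f.toFun a') ≤ C.d (g.toFun a) c ⊔ C.d (g.toFun a') c := by
    rw [f.dist_eq, ← g.dist_eq, C.ultra.2.1 (g.toFun a') c]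
    exact C.ultra.2.2 _ _ _
  calc B.d b b' ≤ B.d b (f.toFun a) ⊔ (B.d (f.toFun a) (f.toFun a') ⊔ B.d (f.toFun a') b') :=
        (B.ultra.2.2 _ _ _).trans (sup_le_sup_left (B.ultra.2.2 _ _ _) _)
    _ ≤ B.d b (f.toFun a) ⊔ ((C.d (g.toFun a) c ⊔ C.d (g.toFun a') c) ⊔ B.d b' (f.toFun a')) := by
        rw [B.ultra.2.1 (f.toFun a') b']
        gcongr
    _ = _ := by ac_rfl

theorem crossDist_apply_apply (f : UltraEmb A B) (g : UltraEmb A C) (a : A.X) :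
    crossDist f g (f.toFun a) (g.toFun a) = ⊥ :=
  le_bot_iff.1 ((crossDist_le f g _ _ a).trans (by simp [UltraSpace.d_self]))

/-- The pseudo-ultrametric on the disjoint union of `B` and `C` that glues them along `A`. -/
noncomputable def glueDist (f : UltraEmb A B) (g : UltraEmb A C) : B.X ⊕ C.X → B.X ⊕ C.X → Λ
  | .inl b, .inl b' => B.d b b'
  | .inl b, .inr c => crossDist f g b c
  | .inr c, .inl b => crossDist f g b c
  | .inr c, .inr c' => C.d c c'

theorem glueDist_self (f : UltraEmb A B) (g : UltraEmb A C) (x : B.X ⊕ C.X) :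
    glueDist f g x x = ⊥ := by
  cases x <;> exact UltraSpace.d_self _ _

theorem glueDist_comm (f : UltraEmb A B) (g : UltraEmb A C) (x y : B.X ⊕ C.X) :
    glueDist f g x y = glueDist f g y x := by
  rcases x with b | c <;> rcases y with b' | c'
  exacts [B.ultra.2.1 _ _, rfl, rfl, C.ultra.2.1 _ _]

theorem glueDist_triangle (f : UltraEmb A B) (g : UltraEmb A C) (x y z : B.X ⊕ C.X) :
    glueDist f g x z ≤ glueDist f g x y ⊔ glueDist f g y z := by
  rcases x with x | x <;> rcases y with y | y <;> rcases z with z | z <;>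
    simp only [glueDist]
  · exact B.ultra.2.2 _ _ _
  · exact crossDist_le_left f g x y z
  · exact dist_le_crossDist f g x z y
  · rw [← crossDist_swap, ← crossDist_swap f g, sup_comm, C.ultra.2.1 y z]
    exact crossDist_le_left g f z y x
  · rw [sup_comm, B.ultra.2.1 y z]
    exact crossDist_le_left f g z y x
  · rw [← crossDist_swap f g, ← crossDist_swap f g]
    exact dist_le_crossDist g f x z y
  · rw [← crossDist_swap f g, ← crossDist_swap f g]
    exact crossDist_le_left g f x y z
  · exact C.ultra.2.2 _ _ _

theorem exists_amalgam (f : UltraEmb A B) (g : UltraEmb A C) :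
    ∃ (D : UltraSpace Λ) (h : UltraEmb B D) (k : UltraEmb C D),
      ∀ a, h.toFun (f.toFun a) = k.toFun (g.toFun a) := by
  obtain ⟨e, he, h_eq⟩ := exists_isUltrametric_quotient (glueDist f g) (glueDist_self f g)
    (glueDist_comm f g) (glueDist_triangle f g)
  have := B.finite
  have := C.finite
  refine ⟨⟨_, inferInstance, e, he⟩, ⟨fun b => Quotient.mk _ (.inl b), fun b b' h => ?_,
    fun b b' => h_eq _ _⟩, ⟨fun c => Quotient.mk _ (.inr c), fun c c' h => ?_,
    fun c c' => h_eq _ _⟩, fun a => Quotient.sound (crossDist_apply_apply f g a)⟩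
  · exact (B.ultra.1 b b').1 (Quotient.exact h)
  · exact (C.ultra.1 c c').1 (Quotient.exact h)

end Amalgam

/-- The class of finite `Λ`-ultrametric spaces has the amalgamation property iff `Λ` is
distributive. -/
theorem ultrametric_amalgamation_iff_distributive
    {Λ : Type*} [Lattice Λ] [BoundedOrder Λ] [Fintype Λ] :
    (∀ (A B C : UltraSpace Λ) (f : UltraEmb A B) (g : UltraEmb A C),
        ∃ (D : UltraSpace Λ) (h : UltraEmb B D) (k : UltraEmb C D),
          ∀ a, h.toFun (f.toFun a) = k.toFun (g.toFun a)) ↔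
      (∀ x y z : Λ, x ⊓ (y ⊔ z) = (x ⊓ y) ⊔ (x ⊓ z)) := by
  refine ⟨fun hAP => ?_, fun h_distrib A B C f g => ?_⟩
  · let : DistribLattice Λ :=
      { ‹Lattice Λ› with le_sup_inf := le_sup_inf_of_amalgamation hAP }
    exact fun x y z => inf_sup_left x y z
  · let : DistribLattice Λ := DistribLattice.ofInfSupLe fun x y z => (h_distrib x y z).le
    exact exists_amalgam f g
end

section
/- Let Λ be a finite distributive lattice and, for i = 1,…,n, let Eᵢ, Fᵢ ∈ Λ with Eᵢ meet-irreducible and Eᵢ ≤ Fᵢ. Let 𝒜* be the class of structures (A, d, <₁, …, <ₙ) where (A, d) is a finite Λ-ultrametric space and each <ᵢ is a subquotient order on A from the equivalence relation {(x,y) : d(x,y) ≤ Eᵢ} to the equivalence relation {(x,y) : d(x,y) ≤ Fᵢ}; embeddings between such structures are injective maps preserving d and each relation <ᵢ (in both directions). Then 𝒜* has the amalgamation property: for all A, B, C in 𝒜* and embeddings f : A → B and g : A → C, there exist D in 𝒜* and embeddings h : B → D, k : C → D with h∘f = k∘g. -/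
/-- Given equivalence relations `E ≤ F` on `X`, a subquotient order from `E` to `F` is a binary
relation `lt` such that: `lt x y` implies `F x y` and not `E x y`; `lt` is `E`-invariant on both
sides; `lt` is transitive; and whenever `F x y` and not `E x y`, exactly one of `lt x y`,
`lt y x` holds. -/
def IsSubquotientOrder {X : Type*} (E F lt : X → X → Prop) : Prop :=
  (∀ x y, lt x y → F x y ∧ ¬ E x y) ∧
  (∀ x y x' y', lt x y → E x x' → E y y' → lt x' y') ∧
  (∀ x y z, lt x y → lt y z → lt x z) ∧
  (∀ x y, F x y → ¬ E x y → ((lt x y ∨ lt y x) ∧ ¬ (lt x y ∧ lt y x)))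

/-- `E` is meet-irreducible: `E ≠ ⊤` and whenever `E = F ⊓ G`, `E = F` or `E = G`. -/
def MeetIrreducible {Λ : Type*} [Lattice Λ] [OrderTop Λ] (E : Λ) : Prop :=
  E ≠ ⊤ ∧ ∀ F G : Λ, E = F ⊓ G → E = F ∨ E = G

/-- A member of the class `𝒜*`: a finite `Λ`-ultrametric space equipped with, for each `i`,
a subquotient order from `{(x,y) : d x y ≤ E i}` to `{(x,y) : d x y ≤ F i}`. -/
structure OrdUltraSpace (Λ : Type*) [Lattice Λ] [OrderBot Λ] (n : ℕ) (E F : Fin n → Λ) where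
  X : Type
  finite : Finite X
  d : X → X → Λ
  ultra : IsUltrametric d
  lt : Fin n → X → X → Prop
  sqo : ∀ i, IsSubquotientOrder (fun x y => d x y ≤ E i) (fun x y => d x y ≤ F i) (lt i)

/-- An embedding in the class `𝒜*`: an injective map preserving the metric and each
subquotient order in both directions. -/
structure OrdUltraEmb {Λ : Type*} [Lattice Λ] [OrderBot Λ] {n : ℕ} {E F : Fin n → Λ}
    (A B : OrdUltraSpace Λ n E F) where
  toFun : A.X → B.X
  inj : Function.Injective toFun
  dist_eq : ∀ x y, B.d (toFun x) (toFun y) = A.d x y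
  lt_iff : ∀ i x y, B.lt i (toFun x) (toFun y) ↔ A.lt i x y

namespace OrdUltraSpace

section Lattice

variable {Λ : Type*} [DistribLattice Λ] [BoundedOrder Λ]

theorem exists_le_of_inf_le {ι : Type*} {s : Finset ι} {v : ι → Λ} {e : Λ}
    (he : MeetIrreducible e) (h : s.inf v ≤ e) : ∃ a ∈ s, v a ≤ e := by
  have hirr : InfIrred e :=
    ⟨fun hm => he.1 (isMax_iff_eq_top.1 hm), fun b c hbc =>
      (he.2 b c hbc.symm).imp Eq.symm Eq.symm⟩
  exact (infPrime_iff_infIrred.2 hirr).finset_inf_le.1 h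

theorem le_sup_inf_of_forall {ι : Type*} {s : Finset ι} {v : ι → Λ} {x y : Λ}
    (h : ∀ a ∈ s, x ≤ y ⊔ v a) : x ≤ y ⊔ s.inf v := by
  rw [Finset.inf_sup_distrib_left]
  exact Finset.le_inf h

end Lattice

/-- Szpilrajn's theorem for preorders: every preorder extends to a total preorder with the same
associated equivalence relation. -/
theorem exists_total_extension {X : Type*} (r : X → X → Prop) (hrefl : ∀ x, r x x)
    (htrans : ∀ x y z, r x y → r y z → r x z) :
    ∃ l : X → X → Prop, (∀ x y, r x y → l x y) ∧ (∀ x y z, l x y → l y z → l x z) ∧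
      (∀ x y, l x y ∨ l y x) ∧ (∀ x y, l x y → l y x → r x y ∧ r y x) := by
  let _ : Preorder X :=
    { le := r
      le_refl := hrefl
      le_trans := htrans }
  obtain ⟨s, hs, hle⟩ :=
    extend_partialOrder ((· ≤ ·) : Antisymmetrization X (· ≤ ·) → _ → Prop)
  refine ⟨fun x y => s (toAntisymmetrization (· ≤ ·) x) (toAntisymmetrization (· ≤ ·) y),
    fun x y h => hle _ _ h, fun x y z => hs.trans _ _ _, fun x y => hs.total _ _, ?_⟩
  intro x y hxy hyx
  exact Quotient.exact (hs.antisymm _ _ hxy hyx)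

theorem _root_.IsSubquotientOrder.comap {X Y : Type*} {E F lt : Y → Y → Prop}
    (h : IsSubquotientOrder E F lt) (p : X → Y) :
    IsSubquotientOrder (fun x y => E (p x) (p y)) (fun x y => F (p x) (p y))
      (fun x y => lt (p x) (p y)) :=
  ⟨fun _ _ => h.1 _ _, fun _ _ _ _ => h.2.1 _ _ _ _, fun _ _ _ => h.2.2.1 _ _ _,
    fun _ _ => h.2.2.2 _ _⟩

section Pseudo

variable {Λ : Type*} [Lattice Λ] [OrderBot Λ]

/-- A distance that may vanish between distinct points and satisfies the other axioms of an
ultrametric. -/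
structure IsPseudoUltrametric {X : Type*} (d : X → X → Λ) : Prop where
  self : ∀ x, d x x = ⊥
  symm : ∀ x y, d x y = d y x
  triangle : ∀ x y z, d x z ≤ d x y ⊔ d y z

theorem _root_.IsUltrametric.self {X : Type*} {d : X → X → Λ} (hd : IsUltrametric d) (x : X) :
    d x x = ⊥ := (hd.1 x x).2 rfl

theorem IsPseudoUltrametric.le_trans {X : Type*} {d : X → X → Λ} (hd : IsPseudoUltrametric d)
    {e : Λ} {x y z : X} (hxy : d x y ≤ e) (hyz : d y z ≤ e) : d x z ≤ e :=
  (hd.triangle x y z).trans (sup_le hxy hyz)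

theorem _root_.IsUltrametric.isPseudoUltrametric {X : Type*} {d : X → X → Λ}
    (hd : IsUltrametric d) : IsPseudoUltrametric d :=
  ⟨hd.self, hd.2.1, hd.2.2⟩

/-- Identifying the points at distance `⊥` turns a pseudo-ultrametric space with subquotient
orders into a member of the class. -/
theorem exists_separation {n : ℕ} {E F : Fin n → Λ} {X : Type} [Finite X] {d : X → X → Λ}
    (hd : IsPseudoUltrametric d) {lt : Fin n → X → X → Prop}
    (hlt : ∀ i, IsSubquotientOrder (fun x y => d x y ≤ E i) (fun x y => d x y ≤ F i) (lt i)) :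
    ∃ (D : OrdUltraSpace Λ n E F) (q : X → D.X),
      (∀ x y, q x = q y ↔ d x y = ⊥) ∧ (∀ x y, D.d (q x) (q y) = d x y) ∧
        ∀ i x y, D.lt i (q x) (q y) ↔ lt i x y := by
  let S : Setoid X :=
    { r := fun x y => d x y = ⊥
      iseqv := ⟨hd.self, fun {x y} h => (hd.symm y x).trans h,
        fun h h' => le_bot_iff.1 (hd.le_trans h.le h'.le)⟩ }
  have hout (x : X) : d (Quotient.mk S x).out x = ⊥ := Quotient.mk_out (s := S) x
  have hout' (x : X) : d x (Quotient.mk S x).out = ⊥ := (hd.symm _ _).trans (hout x)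
  refine ⟨{ X := Quotient S
            finite := inferInstance
            d := fun x y => d x.out y.out
            ultra := ⟨fun x y => ?_, fun x y => hd.symm _ _, fun x y z => hd.triangle _ _ _⟩
            lt := fun i x y => lt i x.out y.out
            sqo := fun i => (hlt i).comap Quotient.out },
    Quotient.mk S, fun x y => Quotient.eq (r := S), fun x y => le_antisymm ?_ ?_,
    fun i x y => ⟨fun h => ?_, fun h => ?_⟩⟩
  · exact Quotient.out_equiv_out (s := S)
  · exact hd.le_trans ((hout x).le.trans bot_le) (hd.le_trans le_rfl ((hout' y).le.trans bot_le))
  · exact hd.le_trans ((hout' x).le.trans bot_le)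
      (hd.le_trans le_rfl ((hout y).le.trans bot_le))
  · exact (hlt i).2.1 _ _ _ _ h ((hout x).le.trans bot_le) ((hout y).le.trans bot_le)
  · exact (hlt i).2.1 _ _ _ _ h ((hout' x).le.trans bot_le) ((hout' y).le.trans bot_le)

/-- A preorder whose equivalence relation is `d x y ≤ e` induces a subquotient order that
contains it on each class of `d x y ≤ f`. -/
theorem exists_isSubquotientOrder {X : Type*} {d : X → X → Λ} (hd : IsPseudoUltrametric d)
    {e f : Λ} (hef : e ≤ f) (r : X → X → Prop) (htrans : ∀ x y z, r x y → r y z → r x z)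
    (hr : ∀ x y, d x y ≤ e ↔ r x y ∧ r y x) :
    ∃ lt : X → X → Prop,
      IsSubquotientOrder (fun x y => d x y ≤ e) (fun x y => d x y ≤ f) lt ∧
        ∀ x y, d x y ≤ f → ¬ d x y ≤ e → r x y → lt x y := by
  have hrefl (x : X) : r x x := ((hr x x).1 ((hd.self x).le.trans bot_le)).1
  obtain ⟨l, hrl, hl, htot, hanti⟩ := exists_total_extension r hrefl htrans
  have hsymm {u : Λ} {x y : X} (h : d x y ≤ u) : d y x ≤ u := (hd.symm y x).le.trans h
  have hle {x y : X} (h : d x y ≤ e) : l x y := hrl _ _ ((hr x y).1 h).1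
  have hanti' {x y : X} (h : l x y) (h' : l y x) : d x y ≤ e := (hr x y).2 (hanti x y h h')
  refine ⟨fun x y => d x y ≤ f ∧ ¬ d x y ≤ e ∧ l x y, ⟨fun x y h => ⟨h.1, h.2.1⟩, ?_, ?_, ?_⟩,
    fun x y h h' hxy => ⟨h, h', hrl x y hxy⟩⟩
  · rintro x y x' y' ⟨hf, he, hxy⟩ hx hy
    exact ⟨hd.le_trans (hsymm (hx.trans hef)) (hd.le_trans hf (hy.trans hef)),
      fun h => he (hd.le_trans hx (hd.le_trans h (hsymm hy))),
      hl _ _ _ (hle (hsymm hx)) (hl _ _ _ hxy (hle hy))⟩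
  · rintro x y z ⟨hf, he, hxy⟩ ⟨hf', -, hyz⟩
    exact ⟨hd.le_trans hf hf', fun h => he (hanti' hxy (hl _ _ _ hyz (hle (hsymm h)))),
      hl _ _ _ hxy hyz⟩
  · intro x y hf he
    exact ⟨(htot x y).imp (fun h => ⟨hf, he, h⟩)
      fun h => ⟨hsymm hf, fun h' => he (hsymm h'), h⟩,
      fun h => he (hanti' h.1.2.2 h.2.2.2)⟩

end Pseudo

section WeakOrder

variable {Λ : Type*} [Lattice Λ] [OrderBot Λ] {n : ℕ} {E F : Fin n → Λ}

/-- The preorder associated with the `i`-th subquotient order. -/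
def le (A : OrdUltraSpace Λ n E F) (i : Fin n) (x y : A.X) : Prop :=
  A.lt i x y ∨ A.d x y ≤ E i

variable (A : OrdUltraSpace Λ n E F) {i : Fin n} {x y z : A.X}

theorem le_trans (hxy : A.le i x y) (hyz : A.le i y z) : A.le i x z := by
  have hd := A.ultra.isPseudoUltrametric
  have hself (w : A.X) : A.d w w ≤ E i := (hd.self w).le.trans bot_le
  rcases hxy with h | h <;> rcases hyz with h' | h'
  · exact .inl ((A.sqo i).2.2.1 _ _ _ h h')
  · exact .inl ((A.sqo i).2.1 _ _ _ _ h (hself x) h')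
  · exact .inl ((A.sqo i).2.1 _ _ _ _ h' ((hd.symm y x).le.trans h) (hself z))
  · exact .inr (hd.le_trans h h')

theorem d_le_iff : A.d x y ≤ E i ↔ A.le i x y ∧ A.le i y x := by
  have hsymm := A.ultra.2.1
  constructor
  · exact fun h => ⟨.inr h, .inr ((hsymm y x).le.trans h)⟩
  · rintro ⟨h | h, h' | h'⟩
    · exact absurd ⟨h, h'⟩ ((A.sqo i).2.2.2 x y ((A.sqo i).1 x y h).1 ((A.sqo i).1 x y h).2).2
    · exact (hsymm x y).le.trans h'
    · exact h
    · exact h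

theorem _root_.OrdUltraEmb.le_iff {A B : OrdUltraSpace Λ n E F} (f : OrdUltraEmb A B) {i : Fin n}
    {x y : A.X} : B.le i (f.toFun x) (f.toFun y) ↔ A.le i x y := by
  rw [le, le, f.lt_iff, f.dist_eq]

/-- A subquotient order with the same parameters that contains `A.lt i` is equal to it. -/
theorem lt_iff_of_imp {lt : A.X → A.X → Prop}
    (hlt : IsSubquotientOrder (fun x y => A.d x y ≤ E i) (fun x y => A.d x y ≤ F i) lt)
    (h : ∀ x y, A.lt i x y → lt x y) : lt x y ↔ A.lt i x y := by
  refine ⟨fun hxy => ?_, h x y⟩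
  obtain ⟨hF, hE⟩ := hlt.1 x y hxy
  exact ((A.sqo i).2.2.2 x y hF hE).1.resolve_right
    fun hyx => (hlt.2.2.2 x y hF hE).2 ⟨hxy, h y x hyx⟩

end WeakOrder

section Amalgam

variable {Λ : Type*} [DistribLattice Λ] [BoundedOrder Λ] {n : ℕ} {E F : Fin n → Λ}
  {A B C : OrdUltraSpace Λ n E F} (f : OrdUltraEmb A B) (g : OrdUltraEmb A C)

/-- The largest distance from a point of `B` to a point of `C` compatible with the triangle
inequality through `A`. -/
noncomputable def crossDist (b : B.X) (c : C.X) : Λ :=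
  letI := @Fintype.ofFinite A.X A.finite
  Finset.univ.inf fun a => B.d b (f.toFun a) ⊔ C.d (g.toFun a) c

/-- The pseudo-ultrametric on the disjoint union of `B` and `C` glued along `A`. -/
noncomputable def glueDist : B.X ⊕ C.X → B.X ⊕ C.X → Λ
  | .inl b, .inl b' => B.d b b'
  | .inr c, .inr c' => C.d c c'
  | .inl b, .inr c => crossDist f g b c
  | .inr c, .inl b => crossDist f g b c

/-- The preorder on the disjoint union of `B` and `C` glued along `A`. -/
def glueLe (i : Fin n) : B.X ⊕ C.X → B.X ⊕ C.X → Prop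
  | .inl b, .inl b' => B.le i b b'
  | .inr c, .inr c' => C.le i c c'
  | .inl b, .inr c => ∃ a, B.le i b (f.toFun a) ∧ C.le i (g.toFun a) c
  | .inr c, .inl b => ∃ a, C.le i c (g.toFun a) ∧ B.le i (f.toFun a) b

variable {f g}

theorem crossDist_le (b : B.X) (c : C.X) (a : A.X) :
    crossDist f g b c ≤ B.d b (f.toFun a) ⊔ C.d (g.toFun a) c :=
  Finset.inf_le (@Finset.mem_univ _ (@Fintype.ofFinite A.X A.finite) a)

theorem le_sup_crossDist {b : B.X} {c : C.X} {u v : Λ}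
    (h : ∀ a, u ≤ v ⊔ (B.d b (f.toFun a) ⊔ C.d (g.toFun a) c)) : u ≤ v ⊔ crossDist f g b c :=
  le_sup_inf_of_forall fun a _ => h a

theorem le_crossDist_sup {b : B.X} {c : C.X} {u v : Λ}
    (h : ∀ a, u ≤ B.d b (f.toFun a) ⊔ C.d (g.toFun a) c ⊔ v) : u ≤ crossDist f g b c ⊔ v :=
  sup_comm v (crossDist f g b c) ▸ le_sup_crossDist fun a => (h a).trans_eq (sup_comm _ _)

theorem crossDist_le_iff {i : Fin n} (he : MeetIrreducible (E i)) {b : B.X} {c : C.X} :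
    crossDist f g b c ≤ E i ↔ ∃ a, B.d b (f.toFun a) ≤ E i ∧ C.d (g.toFun a) c ≤ E i := by
  constructor
  · intro h
    obtain ⟨a, -, ha⟩ := exists_le_of_inf_le he h
    exact ⟨a, sup_le_iff.1 ha⟩
  · rintro ⟨a, ha, ha'⟩
    exact (crossDist_le b c a).trans (sup_le ha ha')

theorem crossDist_triangle_left (b b' : B.X) (c : C.X) :
    crossDist f g b c ≤ B.d b b' ⊔ crossDist f g b' c := by
  refine le_sup_crossDist fun a => (crossDist_le b c a).trans ?_
  rw [← sup_assoc]
  exact sup_le_sup_right (B.ultra.2.2 _ _ _) _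

theorem crossDist_triangle_right (b : B.X) (c c' : C.X) :
    crossDist f g b c ≤ crossDist f g b c' ⊔ C.d c' c := by
  refine le_crossDist_sup fun a => (crossDist_le b c a).trans ?_
  rw [sup_assoc]
  exact sup_le_sup_left (C.ultra.2.2 _ _ _) _

theorem d_le_crossDist_left (b b' : B.X) (c : C.X) :
    B.d b b' ≤ crossDist f g b c ⊔ crossDist f g b' c := by
  refine le_sup_crossDist fun a => le_crossDist_sup fun a' => ?_
  have hB := B.ultra.isPseudoUltrametric
  refine hB.le_trans (le_sup_left.trans le_sup_left)
    (hB.le_trans (y := f.toFun a) ?_ ?_)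
  · rw [f.dist_eq, ← g.dist_eq]
    refine C.ultra.isPseudoUltrametric.le_trans (le_sup_right.trans le_sup_left) ?_
    rw [C.ultra.2.1]
    exact le_sup_right.trans le_sup_right
  · rw [B.ultra.2.1]
    exact le_sup_left.trans le_sup_right

theorem d_le_crossDist_right (b : B.X) (c c' : C.X) :
    C.d c c' ≤ crossDist f g b c ⊔ crossDist f g b c' := by
  refine le_sup_crossDist fun a => le_crossDist_sup fun a' => ?_
  have hC := C.ultra.isPseudoUltrametric
  refine hC.le_trans (y := g.toFun a') ?_ (hC.le_trans (y := g.toFun a) ?_ ?_)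
  · rw [C.ultra.2.1]
    exact le_sup_right.trans le_sup_left
  · rw [g.dist_eq, ← f.dist_eq]
    refine B.ultra.isPseudoUltrametric.le_trans (y := b) ?_ (le_sup_left.trans le_sup_right)
    rw [B.ultra.2.1]
    exact le_sup_left.trans le_sup_left
  · exact le_sup_right.trans le_sup_right

theorem isPseudoUltrametric_glueDist : IsPseudoUltrametric (glueDist f g) where
  self := by
    rintro (b | c)
    exacts [B.ultra.self b, C.ultra.self c]
  symm := by
    rintro (b | c) (b' | c')
    exacts [B.ultra.2.1 b b', rfl, rfl, C.ultra.2.1 c c']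
  triangle := by
    rintro (x | x) (y | y) (z | z) <;> simp only [glueDist]
    · exact B.ultra.2.2 x y z
    · exact crossDist_triangle_left x y z
    · exact d_le_crossDist_left x z y
    · exact crossDist_triangle_right x z y
    · rw [sup_comm, B.ultra.2.1 y z]
      exact crossDist_triangle_left z y x
    · exact d_le_crossDist_right y x z
    · rw [sup_comm, C.ultra.2.1 x y]
      exact crossDist_triangle_right z x y
    · exact C.ultra.2.2 x y z

theorem glueLe_trans {i : Fin n} (x y z : B.X ⊕ C.X) (hxy : glueLe f g i x y)
    (hyz : glueLe f g i y z) : glueLe f g i x z := by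
  have hfg (a a' : A.X) :
      B.le i (f.toFun a) (f.toFun a') ↔ C.le i (g.toFun a) (g.toFun a') := by
    rw [f.le_iff, g.le_iff]
  rcases x with x | x <;> rcases y with y | y <;> rcases z with z | z
  · exact B.le_trans hxy hyz
  · obtain ⟨a, h, h'⟩ := hyz
    exact ⟨a, B.le_trans hxy h, h'⟩
  · obtain ⟨a, h, h'⟩ := hxy
    obtain ⟨a', k, k'⟩ := hyz
    exact B.le_trans h (B.le_trans ((hfg a a').2 (C.le_trans h' k)) k')
  · obtain ⟨a, h, h'⟩ := hxy
    exact ⟨a, h, C.le_trans h' hyz⟩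
  · obtain ⟨a, h, h'⟩ := hxy
    exact ⟨a, h, B.le_trans h' hyz⟩
  · obtain ⟨a, h, h'⟩ := hxy
    obtain ⟨a', k, k'⟩ := hyz
    exact C.le_trans h (C.le_trans ((hfg a a').1 (B.le_trans h' k)) k')
  · obtain ⟨a, h, h'⟩ := hyz
    exact ⟨a, C.le_trans hxy h, h'⟩
  · exact C.le_trans hxy hyz

theorem crossDist_le_iff_glueLe {i : Fin n} (he : MeetIrreducible (E i)) {b : B.X} {c : C.X} :
    crossDist f g b c ≤ E i ↔
      glueLe f g i (.inl b) (.inr c) ∧ glueLe f g i (.inr c) (.inl b) := by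
  rw [crossDist_le_iff he]
  constructor
  · rintro ⟨a, ha, ha'⟩
    rw [d_le_iff] at ha ha'
    exact ⟨⟨a, ha.1, ha'.1⟩, ⟨a, ha'.2, ha.2⟩⟩
  · rintro ⟨⟨a, h, h'⟩, ⟨a', k, k'⟩⟩
    refine ⟨a, B.d_le_iff.2 ⟨h, B.le_trans ?_ k'⟩, C.d_le_iff.2 ⟨h', C.le_trans k ?_⟩⟩
    · exact f.le_iff.2 (g.le_iff.1 (C.le_trans h' k))
    · exact g.le_iff.2 (f.le_iff.1 (B.le_trans k' h))

theorem glueDist_le_iff {i : Fin n} (he : MeetIrreducible (E i)) (x y : B.X ⊕ C.X) :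
    glueDist f g x y ≤ E i ↔ glueLe f g i x y ∧ glueLe f g i y x := by
  rcases x with x | x <;> rcases y with y | y
  · exact B.d_le_iff
  · exact crossDist_le_iff_glueLe he
  · exact (crossDist_le_iff_glueLe he).trans and_comm
  · exact C.d_le_iff

end Amalgam

end OrdUltraSpace

/-- For a finite distributive lattice `Λ` and meet-irreducible bottom relations `E i ≤ F i`,
the class `𝒜*` has the amalgamation property. -/
theorem ordUltraSpace_amalgamation
    {Λ : Type*} [DistribLattice Λ] [BoundedOrder Λ] [Fintype Λ]
    {n : ℕ} (E F : Fin n → Λ)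
    (hirr : ∀ i, MeetIrreducible (E i)) (hEF : ∀ i, E i ≤ F i) :
    ∀ (A B C : OrdUltraSpace Λ n E F) (f : OrdUltraEmb A B) (g : OrdUltraEmb A C),
      ∃ (D : OrdUltraSpace Λ n E F) (h : OrdUltraEmb B D) (k : OrdUltraEmb C D),
        ∀ a, h.toFun (f.toFun a) = k.toFun (g.toFun a) := by
  intro A B C f g
  have hd := OrdUltraSpace.isPseudoUltrametric_glueDist (f := f) (g := g)
  have hfinB := B.finite
  have hfinC := C.finite
  choose lt hlt hle using fun i => OrdUltraSpace.exists_isSubquotientOrder hd (hEF i)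
    (OrdUltraSpace.glueLe f g i) OrdUltraSpace.glueLe_trans
    (OrdUltraSpace.glueDist_le_iff (hirr i))
  obtain ⟨D, q, hq, hqd, hqlt⟩ := OrdUltraSpace.exists_separation hd hlt
  refine ⟨D, ⟨fun b => q (.inl b), fun b b' h => (B.ultra.1 b b').1 ((hq _ _).1 h),
      fun b b' => hqd _ _, fun i b b' => (hqlt i _ _).trans ?_⟩,
    ⟨fun c => q (.inr c), fun c c' h => (C.ultra.1 c c').1 ((hq _ _).1 h),
      fun c c' => hqd _ _, fun i c c' => (hqlt i _ _).trans ?_⟩, fun a => (hq _ _).2 ?_⟩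
  · refine B.lt_iff_of_imp ((hlt i).comap Sum.inl) fun x y h => ?_
    obtain ⟨hF, hE⟩ := (B.sqo i).1 x y h
    exact hle i _ _ hF hE (.inl h)
  · refine C.lt_iff_of_imp ((hlt i).comap Sum.inr) fun x y h => ?_
    obtain ⟨hF, hE⟩ := (C.sqo i).1 x y h
    exact hle i _ _ hF hE (.inl h)
  · refine le_bot_iff.1 ((OrdUltraSpace.crossDist_le _ _ a).trans ?_)
    rw [B.ultra.self, C.ultra.self, sup_bot_eq]
end

section
/- Let Γ = (Γ; ≤₁, …, ≤ₙ) be a homogeneous n-dimensional permutation structure that is primitive, i.e., the only ∅-definable equivalence relations on Γ are the equality relation and the trivial relation, and such that no two of the orders ≤₁, …, ≤ₙ are equal and no ≤ᵢ is the reverse of another ≤ⱼ. Then Γ is the Fraïssé limit of the class of all finite sets equipped with n linear orders; concretely, for every finite subset A ⊆ Γ and every choice, for each i ≤ n, of an initial segment Lᵢ of (A, ≤ᵢ), there exists x ∈ Γ \ A such that for all a ∈ A and all i ≤ n: a <ᵢ x if and only if a ∈ Lᵢ. -/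
/-- An `n`-dimensional permutation structure: a set `Γ` equipped with `n` linear orders. -/
structure PermStruct (n : ℕ) (Γ : Type*) where
  le : Fin n → Γ → Γ → Prop
  total : ∀ i x y, le i x y ∨ le i y x
  antisymm : ∀ i x y, le i x y → le i y x → x = y
  trans : ∀ i x y z, le i x y → le i y z → le i x z

namespace PermStruct

variable {n : ℕ} {Γ : Type*} (S : PermStruct n Γ)

/-- An automorphism of the permutation structure: a bijection of `Γ` preserving each order. -/
def IsAuto (σ : Γ ≃ Γ) : Prop :=
  ∀ i x y, S.le i x y ↔ S.le i (σ x) (σ y)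

/-- Homogeneity: every isomorphism between finite substructures (i.e. every bijection between
finite subsets preserving each order) extends to an automorphism. -/
def Homogeneous : Prop :=
  ∀ (A : Finset Γ) (f : Γ → Γ), Set.InjOn f A →
    (∀ i, ∀ x ∈ A, ∀ y ∈ A, (S.le i x y ↔ S.le i (f x) (f y))) →
    ∃ σ : Γ ≃ Γ, S.IsAuto σ ∧ ∀ a ∈ A, σ a = f a

/-- A binary relation is ∅-definable iff it is invariant under all automorphisms. -/
def Definable (R : Γ → Γ → Prop) : Prop :=
  ∀ σ : Γ ≃ Γ, S.IsAuto σ → ∀ x y, R x y ↔ R (σ x) (σ y)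

/-- `E` is `≤ᵢ`-convex: every `E`-class is an interval with respect to `≤ᵢ`. -/
def Convex (i : Fin n) (E : Γ → Γ → Prop) : Prop :=
  ∀ x y z, S.le i x y → S.le i y z → E x z → E x y

end PermStruct

namespace OrderedAction

variable {Γ : Type*}

/-- A relation is invariant under a group of permutations. -/
def Invar (G : Subgroup (Equiv.Perm Γ)) (R : Γ → Γ → Prop) : Prop :=
  ∀ g ∈ G, ∀ x y, R x y → R (g x) (g y)

/-- A strict linear order invariant under a group of permutations. -/
structure InvOrder (G : Subgroup (Equiv.Perm Γ)) (r : Γ → Γ → Prop) : Prop where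
  inv : Invar G r
  irrefl : ∀ x, ¬ r x x
  trans : ∀ {x y z}, r x y → r y z → r x z
  total : ∀ {x y}, x ≠ y → r x y ∨ r y x

/-- A primitive permutation group with finitely many orbits on pairs, whose orbits on finite tuples
are determined by the invariant linear orders. -/
structure Tame (G : Subgroup (Equiv.Perm Γ)) : Prop where
  hom : ∀ {ι : Type} [Finite ι] (x y : ι → Γ),
    (∀ r, InvOrder G r → ∀ i j, r (x i) (x j) ↔ r (y i) (y j)) → ∃ g ∈ G, ∀ i, g (x i) = y i
  prim : ∀ E, Invar G E → Equivalence E → (∀ x y, E x y → x = y) ∨ ∀ x y, E x y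
  fin : {R | Invar G R}.Finite
  nontriv : Nontrivial Γ

/-- An invariant family `a ↦ P a` of initial segments of the order `k`. -/
structure Cut (G : Subgroup (Equiv.Perm Γ)) (k P : Γ → Γ → Prop) : Prop where
  inv : Invar G P
  initial : ∀ {a x y}, P a x → k y x → P a y

/-- The order `k` is top if there is no proper invariant cut strictly above each point. -/
def Top (G : Subgroup (Equiv.Perm Γ)) (k : Γ → Γ → Prop) : Prop :=
  ∀ P, Cut G k P → (∀ a, P a a) → (∃ a x, k a x ∧ P a x) → ∀ a x, P a x

/-- `a` is below `b` in all the orders of `S`. -/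
def Below (S : Set (Γ → Γ → Prop)) (a b : Γ) : Prop := ∀ r ∈ S, r a b

/-- Every finite set has a common lower bound for all the orders of `S`. -/
def Avail (S : Set (Γ → Γ → Prop)) : Prop :=
  ∀ B : Set Γ, B.Finite → ∃ a, ∀ b ∈ B, Below S a b

/-- An available set of invariant orders containing each invariant order or its reverse. -/
structure Good (G : Subgroup (Equiv.Perm Γ)) (S : Set (Γ → Γ → Prop)) : Prop where
  ord : ∀ r ∈ S, InvOrder G r
  avail : Avail S
  full : ∀ r, InvOrder G r → r ∈ S ∨ flip r ∈ S

/-- Two orders are independent at infinity. -/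
def Perp (i l : Γ → Γ → Prop) : Prop :=
  (Avail {i, l} ∧ Avail {i, flip l}) ∧ (Avail {flip i, l} ∧ Avail {flip i, flip l})

/-- Going down along `r` forces going down along `q`. -/
def Prec (r q : Γ → Γ → Prop) : Prop := ∀ b, ∃ a, ∀ x, r x a → q x b

/-- The comparison of the cuts `P a` by inclusion. -/
def CutLt (P : Γ → Γ → Prop) (a b : Γ) : Prop := ∃ x, P b x ∧ ¬ P a x

section basic

variable {G : Subgroup (Equiv.Perm Γ)} {r q k l i m f P Q R : Γ → Γ → Prop}

theorem Invar.iff (h : Invar G R) {g : Equiv.Perm Γ} (hg : g ∈ G) (x y : Γ) :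
    R (g x) (g y) ↔ R x y :=
  ⟨fun H => by simpa using h g⁻¹ (G.inv_mem hg) _ _ H, h g hg x y⟩

theorem InvOrder.flip (h : InvOrder G r) : InvOrder G (flip r) where
  inv g hg x y H := h.inv g hg y x H
  irrefl x := h.irrefl x
  trans h1 h2 := h.trans h2 h1
  total hne := (h.total hne).symm

theorem InvOrder.asymm (h : InvOrder G r) {x y : Γ} (h1 : r x y) : ¬ r y x :=
  fun h2 => h.irrefl _ (h.trans h1 h2)

theorem InvOrder.ne (h : InvOrder G r) {x y : Γ} (h1 : r x y) : x ≠ y := by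
  rintro rfl; exact h.irrefl _ h1

theorem InvOrder.lt_of_not (h : InvOrder G r) {x y : Γ} (hne : x ≠ y) (h1 : ¬ r x y) : r y x :=
  (h.total hne).resolve_left h1

theorem InvOrder.lt_of_not_of_lt (h : InvOrder G r) {x y z : Γ} (h1 : ¬ r y x) (h2 : r y z) :
    r x z := by
  rcases eq_or_ne x y with rfl | hne
  · exact h2
  · exact h.trans (h.lt_of_not hne.symm h1) h2

theorem InvOrder.lt_of_lt_of_not (h : InvOrder G r) {x y z : Γ} (h1 : r x y) (h2 : ¬ r z y) :
    r x z := by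
  rcases eq_or_ne y z with rfl | hne
  · exact h1
  · exact h.trans h1 (h.lt_of_not hne.symm h2)

theorem InvOrder.eq_of_imp (h : InvOrder G r) (h' : InvOrder G q) (H : ∀ x y, r x y → q x y) :
    r = q := by
  funext x y
  refine propext ⟨H x y, fun hq => h.lt_of_not (h'.ne hq).symm fun hr => ?_⟩
  exact h'.asymm hq (H _ _ hr)

theorem Tame.finite_orders (hG : Tame G) : {r | InvOrder G r}.Finite :=
  hG.fin.subset fun _ hr => hr.inv

theorem Tame.trans (hG : Tame G) (a b : Γ) : ∃ g ∈ G, g a = b := by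
  obtain ⟨g, hg, h⟩ := hG.hom (fun _ : Unit => a) (fun _ => b) fun r hr _ _ =>
    iff_of_false (hr.irrefl _) (hr.irrefl _)
  exact ⟨g, hg, h ()⟩

/-- An invariant property holding somewhere holds everywhere. -/
theorem Tame.forall_of (hG : Tame G) {p : Γ → Prop} (hp : ∀ g ∈ G, ∀ x, p x → p (g x)) {a : Γ}
    (ha : p a) (x : Γ) : p x := by
  obtain ⟨g, hg, rfl⟩ := hG.trans a x
  exact hp g hg a ha

theorem Tame.exists_lt (hG : Tame G) (hr : InvOrder G r) (a : Γ) : ∃ x, r x a := by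
  have inv : ∀ g ∈ G, ∀ a, (∃ x, r x a) → ∃ x, r x (g a) := fun g hg a ⟨x, hx⟩ =>
    ⟨g x, hr.inv g hg _ _ hx⟩
  obtain ⟨x, y, hxy⟩ := hG.nontriv
  rcases hr.total hxy with h | h
  · exact hG.forall_of inv ⟨_, h⟩ a
  · exact hG.forall_of inv ⟨_, h⟩ a

theorem Tame.exists_gt (hG : Tame G) (hr : InvOrder G r) (a : Γ) : ∃ x, r a x :=
  hG.exists_lt hr.flip a

theorem Avail.mono {S T : Set (Γ → Γ → Prop)} (h : Avail T) (hST : S ⊆ T) : Avail S :=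
  fun B hB => (h B hB).imp fun _ ha b hb r hr => ha b hb r (hST hr)

theorem Tame.avail_singleton (hG : Tame G) (hr : InvOrder G r) : Avail {r} := by
  intro B hB
  induction B, hB using Set.Finite.induction_on with
  | empty => obtain ⟨x, -⟩ := hG.nontriv; exact ⟨x, by simp⟩
  | @insert b B _ _ ih =>
    obtain ⟨a, ha⟩ := ih
    simp only [Below, Set.mem_singleton_iff, forall_eq, Set.mem_insert_iff, forall_eq_or_imp]
      at ha ⊢
    by_cases hab : r a b
    · exact ⟨a, hab, ha⟩
    · obtain ⟨c, hc⟩ := hG.exists_lt hr b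
      refine ⟨c, hc, fun x hx => hr.trans ?_ (ha x hx)⟩
      exact hr.lt_of_lt_of_not hc hab

theorem Tame.avail_pair_iff (hG : Tame G) (hr : InvOrder G r) (hq : InvOrder G q) :
    Avail {r, q} ↔ ∀ a b, ∃ x, r x a ∧ q x b := by
  constructor
  · intro h a b
    obtain ⟨x, hx⟩ := h {a, b} (by simp)
    exact ⟨x, hx a (by simp) r (by simp), hx b (by simp) q (by simp)⟩
  · intro h B hB
    obtain ⟨a, ha⟩ := hG.avail_singleton hr B hB
    obtain ⟨b, hb⟩ := hG.avail_singleton hq B hB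
    obtain ⟨x, hxa, hxb⟩ := h a b
    refine ⟨x, fun c hc s hs => ?_⟩
    rcases hs with rfl | rfl
    · exact hr.trans hxa (ha c hc _ rfl)
    · exact hq.trans hxb (hb c hc _ rfl)

/-- An available set of orders stays available after adding an order or its reverse. -/
theorem Tame.avail_insert (hG : Tame G) {S : Set (Γ → Γ → Prop)} (hS : ∀ s ∈ S, InvOrder G s)
    (h : Avail S) (hr : InvOrder G r) : Avail (insert r S) ∨ Avail (insert (flip r) S) := by
  by_contra! hcon
  obtain ⟨h1, h2⟩ := hcon
  simp only [Avail, not_forall, not_exists] at h1 h2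
  obtain ⟨B₁, hB₁, h1⟩ := h1
  obtain ⟨B₂, hB₂, h2⟩ := h2
  have hB := hB₁.union hB₂
  obtain ⟨u, hu⟩ := hG.avail_singleton hr _ hB
  obtain ⟨v, hv⟩ := hG.avail_singleton hr.flip _ hB
  have key : ∀ a, (∀ b ∈ B₁ ∪ B₂, Below S a b) → r u a ∧ r a v := by
    intro a ha
    constructor
    · by_contra hua
      obtain ⟨b, hb, hn⟩ := h1 a
      refine hn fun s hs => ?_
      rcases hs with rfl | hs
      · exact hr.lt_of_not_of_lt hua (hu b (.inl hb) _ rfl)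
      · exact ha b (.inl hb) s hs
    · by_contra hav
      obtain ⟨b, hb, hn⟩ := h2 a
      refine hn fun s hs => ?_
      rcases hs with rfl | hs
      · exact hr.lt_of_lt_of_not (hv b (.inr hb) _ rfl) hav
      · exact ha b (.inr hb) s hs
  obtain ⟨g, hg, hguv⟩ := hG.trans u v
  obtain ⟨a, ha⟩ := h ((B₁ ∪ B₂) ∪ g '' (B₁ ∪ B₂)) (hB.union (hB.image g))
  have h3 := (key a fun b hb => ha b (.inl hb)).2
  have h4 := (key (g⁻¹ a) fun b hb s hs => by
    have := (hS s hs).inv _ (G.inv_mem hg) _ _ (ha (g b) (.inr ⟨b, hb, rfl⟩) s hs)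
    simpa using this).1
  have h5 := hr.inv g hg _ _ h4
  rw [hguv] at h5
  exact hr.asymm h3 (by simpa using h5)

theorem Tame.exists_good (hG : Tame G) {S : Set (Γ → Γ → Prop)} (hS : ∀ s ∈ S, InvOrder G s)
    (h : Avail S) : ∃ T, S ⊆ T ∧ Good G T := by
  have hfin : {T : Set (Γ → Γ → Prop) | T ⊆ {r | InvOrder G r} ∧ Avail T}.Finite :=
    hG.finite_orders.finite_subsets.subset fun T hT => hT.1
  obtain ⟨T, hST, hT⟩ := hfin.exists_le_maximal (a := S) ⟨hS, h⟩
  refine ⟨T, hST, hT.prop.1, hT.prop.2, fun r hr => ?_⟩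
  rcases hG.avail_insert hT.prop.1 hT.prop.2 hr with h' | h'
  · exact .inl (hT.le_of_ge (y := insert r T) ⟨Set.insert_subset hr hT.prop.1, h'⟩
      (Set.subset_insert _ _) (Set.mem_insert _ _))
  · exact .inr (hT.le_of_ge (y := insert (_root_.flip r) T)
      ⟨Set.insert_subset hr.flip hT.prop.1, h'⟩ (Set.subset_insert _ _) (Set.mem_insert _ _))

/-- Over a point below them, the position of a pair does not depend on the point. -/
theorem Good.conj {S : Set (Γ → Γ → Prop)} (hG : Tame G) (hS : Good G S) {a a' u v : Γ}
    (h1 : Below S a u) (h2 : Below S a v) (h1' : Below S a' u) (h2' : Below S a' v) :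
    ∃ g ∈ G, g a = a' ∧ g u = u ∧ g v = v := by
  have key : ∀ r, InvOrder G r → ∀ w, Below S a w → Below S a' w →
      ((r a w ↔ r a' w) ∧ (r w a ↔ r w a')) := by
    intro r hr w hw hw'
    rcases hS.full r hr with h | h
    · have h1 := hw _ h
      have h2 := hw' _ h
      exact ⟨iff_of_true h1 h2, iff_of_false (hr.asymm h1) (hr.asymm h2)⟩
    · have h1 := hw _ h
      have h2 := hw' _ h
      exact ⟨iff_of_false (hr.asymm h1) (hr.asymm h2), iff_of_true h1 h2⟩
  obtain ⟨g, hg, h⟩ := hG.hom ![a, u, v] ![a', u, v] (by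
    intro r hr
    have hu := key r hr u h1 h1'
    have hv := key r hr v h2 h2'
    have := hr.irrefl
    simp [Fin.forall_fin_succ, hu, hv, this])
  exact ⟨g, hg, h 0, h 1, h 2⟩

theorem Good.conj_pair {S : Set (Γ → Γ → Prop)} (hG : Tame G) (hS : Good G S) {a a' u u' : Γ}
    (h1 : Below S a u) (h1' : Below S a' u') : ∃ g ∈ G, g a = a' ∧ g u = u' := by
  have key : ∀ r, InvOrder G r → ((r a u ↔ r a' u') ∧ (r u a ↔ r u' a')) := by
    intro r hr
    rcases hS.full r hr with h | h
    · have h1 := h1 _ h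
      have h2 := h1' _ h
      exact ⟨iff_of_true h1 h2, iff_of_false (hr.asymm h1) (hr.asymm h2)⟩
    · have h1 := h1 _ h
      have h2 := h1' _ h
      exact ⟨iff_of_false (hr.asymm h1) (hr.asymm h2), iff_of_true h1 h2⟩
  obtain ⟨g, hg, h⟩ := hG.hom ![a, u] ![a', u'] (by
    intro r hr
    have hu := key r hr
    have := hr.irrefl
    simp [Fin.forall_fin_succ, hu, this])
  exact ⟨g, hg, h 0, h 1⟩

theorem Below.map {S : Set (Γ → Γ → Prop)} (hS : ∀ r ∈ S, InvOrder G r) {a b : Γ}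
    (h : Below S a b) {g : Equiv.Perm Γ} (hg : g ∈ G) : Below S (g a) (g b) :=
  fun r hr => (hS r hr).inv g hg _ _ (h r hr)

theorem Below.trans {S : Set (Γ → Γ → Prop)} (hS : ∀ r ∈ S, InvOrder G r) {a b c : Γ}
    (h : Below S a b) (h' : Below S b c) : Below S a c :=
  fun r hr => (hS r hr).trans (h r hr) (h' r hr)

theorem Good.exists_below {S : Set (Γ → Γ → Prop)} (hG : Tame G) (hS : Good G S) (a : Γ) :
    ∃ b, Below S a b := by
  obtain ⟨c, hc⟩ := hS.avail {a} (by simp)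
  exact hG.forall_of (p := fun a => ∃ b, Below S a b)
    (fun g hg x ⟨b, hb⟩ => ⟨g b, hb.map hS.ord hg⟩) ⟨a, hc a rfl⟩ a

theorem Good.cofinal {S : Set (Γ → Γ → Prop)} (hG : Tame G) (hS : Good G S) (hk : k ∈ S)
    (ht : Top G k) (a x : Γ) : ∃ b, Below S a b ∧ k x b := by
  have ho := hS.ord k hk
  obtain ⟨y, hy⟩ := hG.exists_gt ho x
  have := ht (fun a x => ∃ b, Below S a b ∧ ¬ k b x) ⟨?_, ?_⟩ ?_ ?_ a y
  · obtain ⟨b, hb, hb'⟩ := this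
    exact ⟨b, hb, ho.lt_of_lt_of_not hy hb'⟩
  · rintro g hg a x ⟨b, hb, hb'⟩
    exact ⟨g b, hb.map hS.ord hg, by rwa [ho.inv.iff hg]⟩
  · rintro a x y ⟨b, hb, hb'⟩ hyx
    exact ⟨b, hb, fun h => hb' (ho.trans h hyx)⟩
  · intro a
    obtain ⟨b, hb⟩ := hS.exists_below hG a
    exact ⟨b, hb, ho.asymm (hb k hk)⟩
  · obtain ⟨b, hb⟩ := hS.exists_below hG a
    exact ⟨a, b, hb k hk, b, hb, ho.irrefl b⟩

theorem Good.coinitial {S : Set (Γ → Γ → Prop)} (hG : Tame G) (hS : Good G S) (hk : k ∈ S)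
    (ht : Top G k) {a x : Γ} (hax : k a x) : ∃ b, Below S a b ∧ k b x := by
  have ho := hS.ord k hk
  by_contra! hcon
  obtain ⟨b, hb⟩ := hS.exists_below hG a
  obtain ⟨c, hc⟩ := hG.exists_gt ho b
  refine ht (fun a x => ∀ b, Below S a b → ¬ k b x) ⟨?_, ?_⟩ ?_ ⟨a, x, hax, hcon⟩ a c b hb hc
  · intro g hg a x h b hb hbx
    obtain ⟨b, rfl⟩ := g.surjective b
    exact h b (by simpa using hb.map hS.ord (G.inv_mem hg)) ((ho.inv.iff hg _ _).1 hbx)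
  · exact fun h hyx b hb hby => h b hb (ho.trans hby hyx)
  · exact fun a b hb => ho.asymm (hb k hk)

/-- Density over a point at infinity. -/
theorem Good.dense {S : Set (Γ → Γ → Prop)} (hG : Tame G) (hS : Good G S) (hk : k ∈ S)
    (ht : Top G k) {W : Γ → Γ → Prop} (hW : Invar G W) (hex : ∃ a d, k a d ∧ W a d) {a b c : Γ}
    (hb : Below S a b) (hc : Below S a c) (hbc : k b c) : ∃ d, k b d ∧ k d c ∧ W a d := by
  have ho := hS.ord k hk
  by_contra! hcon
  have transfer : ∀ a a' u v, Below S a u → Below S a v → Below S a' u → Below S a' v →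
      (∀ d, k u d → k d v → ¬ W a d) → ∀ d, k u d → k d v → ¬ W a' d := by
    intro a a' u v h1 h2 h1' h2' H d hd hd' hw
    obtain ⟨g, hg, rfl, hu, hv⟩ := hS.conj hG h1 h2 h1' h2'
    obtain ⟨d, rfl⟩ := g.surjective d
    rw [← hu, ho.inv.iff hg] at hd
    rw [← hv, ho.inv.iff hg] at hd'
    exact H d hd hd' ((hW.iff hg _ _).1 hw)
  have hP := ht (fun u v => k u v → ∃ a, Below S a u ∧ Below S a v ∧
      ∀ d, k u d → k d v → ¬ W a d) ⟨?_, ?_⟩ (fun a h => (ho.irrefl a h).elim)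
      ⟨b, c, hbc, fun _ => ⟨a, hb, hc, hcon⟩⟩
  · obtain ⟨a₁, d₁, h1, h2⟩ := hex
    obtain ⟨b₁, hb₁, hbd⟩ := hS.coinitial hG hk ht h1
    obtain ⟨c₁, hc₁, hcd⟩ := hS.cofinal hG hk ht a₁ d₁
    obtain ⟨a₂, h3, h4, h5⟩ := hP b₁ c₁ (ho.trans hbd hcd)
    exact transfer _ _ _ _ h3 h4 hb₁ hc₁ h5 d₁ hbd hcd h2
  · intro g hg u v H huv
    obtain ⟨a, h1, h2, h3⟩ := H ((ho.inv.iff hg _ _).1 huv)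
    refine ⟨g a, h1.map hS.ord hg, h2.map hS.ord hg, fun d hd hd' hw => ?_⟩
    obtain ⟨d, rfl⟩ := g.surjective d
    exact h3 d ((ho.inv.iff hg _ _).1 hd) ((ho.inv.iff hg _ _).1 hd') ((hW.iff hg _ _).1 hw)
  · intro u v v' H hv' huv'
    obtain ⟨a, h1, h2, h3⟩ := H (ho.trans huv' hv')
    obtain ⟨a', ha'⟩ := hS.avail {u, v, v'} (by simp)
    refine ⟨a', ha' _ (by simp), ha' _ (by simp), fun d hd hd' => ?_⟩
    exact transfer a a' u v h1 h2 (ha' _ (by simp)) (ha' _ (by simp)) h3 d hd (ho.trans hd' hv')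

/-- An invariant relation, upward monotone for two orders with two opposite corners, is trivial. -/
theorem Tame.monotone_trivial (hG : Tame G) (h1 : Avail {i, l})
    (h2 : Avail {flip i, flip l}) (hi : InvOrder G i) (hl : InvOrder G l) (hQ : Invar G Q)
    (hmono : ∀ b c b' c', Q b c → ¬ i b' b → ¬ l c' c → Q b' c') {b c : Γ} (h : Q b c)
    (b' c' : Γ) : Q b' c' := by
  obtain ⟨x, hx⟩ := h2 {b, c} (by simp)
  have hxx : Q x x := hmono b c x x h (hi.asymm (hx b (by simp) (flip i) (by simp)))
    (hl.asymm (hx c (by simp) (flip l) (by simp)))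
  obtain ⟨y, hy⟩ := h1 {b', c'} (by simp)
  have hyy : Q y y := hG.forall_of (p := fun y => Q y y) (fun g hg x h => hQ g hg _ _ h) hxx y
  exact hmono y y b' c' hyy (hi.asymm (hy b' (by simp) i (by simp)))
    (hl.asymm (hy c' (by simp) l (by simp)))

end basic

section perp

variable {G : Subgroup (Equiv.Perm Γ)} {r q k l i m f P Q R : Γ → Γ → Prop}

theorem Tame.avail_insert_of_perp (hG : Tame G) {F : Set (Γ → Γ → Prop)} (hF : F.Finite)
    (ho : ∀ f ∈ F, InvOrder G f ∧ Top G f) (hp : F.Pairwise Perp) (hl : InvOrder G l)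
    (hlF : ∀ f ∈ F, Perp f l) : Avail (insert l F) := by
  induction F, hF using Set.Finite.induction_on generalizing l with
  | empty => simpa using hG.avail_singleton hl
  | @insert i F hiF hF ih =>
    have ho' : ∀ f ∈ F, InvOrder G f ∧ Top G f := fun f hf => ho f (.inr hf)
    have hp' : F.Pairwise Perp := hp.mono (Set.subset_insert _ _)
    have hi := ho i (.inl rfl)
    have hAi : Avail (insert i F) := ih ho' hp' hi.1 fun f hf =>
      hp (.inr hf) (.inl rfl) (by rintro rfl; exact hiF hf)
    have hAl : Avail (insert l F) := ih ho' hp' hl fun f hf => hlF f (.inr hf)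
    obtain ⟨T, hT, hgood⟩ := hG.exists_good (S := insert i F) (fun s hs => (ho s hs).1) hAi
    have hiT : i ∈ T := hT (.inl rfl)
    have hinv : Invar G fun b c => ∃ a, Below T a b ∧ Below T a c ∧
        ∃ x, (∀ j ∈ F, j x a) ∧ i x b ∧ l x c := by
      rintro g hg b c ⟨a, hab, hac, x, hxa, hxb, hxc⟩
      exact ⟨g a, hab.map hgood.ord hg, hac.map hgood.ord hg, g x,
        fun j hj => (ho' j hj).1.inv g hg _ _ (hxa j hj), hi.1.inv g hg _ _ hxb,
        hl.inv g hg _ _ hxc⟩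
    have move : ∀ b c a', (∃ a, Below T a b ∧ Below T a c ∧
        ∃ x, (∀ j ∈ F, j x a) ∧ i x b ∧ l x c) → Below T a' b → Below T a' c →
        ∃ x, (∀ j ∈ F, j x a') ∧ i x b ∧ l x c := by
      rintro b c a' ⟨a, hab, hac, x, hxa, hxb, hxc⟩ hb hc
      obtain ⟨g, hg, rfl, hgb, hgc⟩ := hgood.conj hG hab hac hb hc
      refine ⟨g x, fun j hj => (ho' j hj).1.inv g hg _ _ (hxa j hj), ?_, ?_⟩
      · have := hi.1.inv g hg _ _ hxb
        rwa [hgb] at this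
      · have := hl.inv g hg _ _ hxc
        rwa [hgc] at this
    have hex : ∃ b c a, Below T a b ∧ Below T a c ∧
        ∃ x, (∀ j ∈ F, j x a) ∧ i x b ∧ l x c := by
      obtain ⟨c, -⟩ := hG.nontriv
      obtain ⟨a, ha⟩ := hgood.avail {c} (by simp)
      obtain ⟨x, hx⟩ := hAl {a, c} (by simp)
      obtain ⟨b, hab, hxb⟩ := hgood.cofinal hG hiT hi.2 a x
      exact ⟨b, c, a, hab, ha c rfl, x, fun j hj => hx a (by simp) j (.inr hj), hxb,
        hx c (by simp) l (.inl rfl)⟩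
    obtain ⟨b₀, c₀, h₀⟩ := hex
    have hall := hG.monotone_trivial (hlF i (.inl rfl)).1.1 (hlF i (.inl rfl)).2.2 hi.1 hl hinv
      (by
        intro b c b' c' H hb hc
        obtain ⟨a, ha⟩ := hgood.avail {b, c, b', c'} (by simp)
        obtain ⟨x, h1, h2, h3⟩ := move b c a H (ha _ (by simp)) (ha _ (by simp))
        exact ⟨a, ha _ (by simp), ha _ (by simp), x, h1, hi.1.lt_of_lt_of_not h2 hb,
          hl.lt_of_lt_of_not h3 hc⟩) h₀
    intro B hB
    obtain ⟨b, hb⟩ := hG.avail_singleton hi.1 B hB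
    obtain ⟨c, hc⟩ := hG.avail_singleton hl B hB
    obtain ⟨a, ha⟩ := hgood.avail (insert b (insert c B)) ((hB.insert c).insert b)
    obtain ⟨x, h1, h2, h3⟩ := move b c a (hall b c) (ha _ (by simp)) (ha _ (by simp))
    refine ⟨x, fun y hy s hs => ?_⟩
    rcases hs with rfl | rfl | hs
    · exact hl.trans h3 (hc y hy _ rfl)
    · exact hi.1.trans h2 (hb y hy _ rfl)
    · exact (ho' s hs).1.trans (h1 s hs) (ha y (by simp [hy]) s (hT (.inr hs)))

theorem Tame.avail_of_perp (hG : Tame G) {F : Set (Γ → Γ → Prop)} (hF : F.Finite)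
    (ho : ∀ f ∈ F, InvOrder G f ∧ Top G f) (hp : F.Pairwise Perp) : Avail F := by
  rcases F.eq_empty_or_nonempty with rfl | ⟨i, hi⟩
  · obtain ⟨x, -⟩ := hG.nontriv
    exact fun B _ => ⟨x, fun b _ r hr => hr.elim⟩
  · have h := hG.avail_insert_of_perp (F := F \ {i}) (l := i) (hF.subset Set.sdiff_subset)
      (fun f hf => ho f hf.1) (hp.mono Set.sdiff_subset) (ho i hi).1
      (fun f hf => hp hf.1 hi hf.2)
    rwa [Set.insert_sdiff_singleton, Set.insert_eq_of_mem hi] at h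

theorem Prec.refl (r : Γ → Γ → Prop) : Prec r r := fun b => ⟨b, fun _ h => h⟩

theorem Prec.trans (h : Prec r q) (h' : Prec q k) : Prec r k := fun b => by
  obtain ⟨a, ha⟩ := h' b
  obtain ⟨c, hc⟩ := h a
  exact ⟨c, fun x hx => ha x (hc x hx)⟩

theorem Tame.prec_of (hG : Tame G) (hr : InvOrder G r) (hq : InvOrder G q)
    (h : ∃ a b, ∀ x, r x a → ¬ q b x) : Prec r q := by
  obtain ⟨a, b, h⟩ := h
  obtain ⟨c, hc⟩ := hG.exists_gt hq b
  refine hG.forall_of (p := fun c => ∃ a, ∀ x, r x a → q x c) ?_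
    (⟨a, fun x hx => hq.lt_of_not_of_lt (h x hx) hc⟩ : ∃ a, ∀ x, r x a → q x c)
  rintro g hg b ⟨a, ha⟩
  refine ⟨g a, fun x hx => ?_⟩
  obtain ⟨x, rfl⟩ := g.surjective x
  exact hq.inv g hg _ _ (ha x ((hr.inv.iff hg _ _).1 hx))

theorem Tame.prec_of_not_avail (hG : Tame G) (hr : InvOrder G r) (hq : InvOrder G q)
    (h : ¬ Avail {r, flip q}) : Prec r q := by
  rw [hG.avail_pair_iff hr hq.flip] at h
  push Not at h
  exact hG.prec_of hr hq h

theorem Tame.prec_flip (hG : Tame G) (hr : InvOrder G r) (hq : InvOrder G q) (h : Prec r q) :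
    Prec (flip q) (flip r) := by
  obtain ⟨b, -⟩ := hG.nontriv
  obtain ⟨a, ha⟩ := h b
  exact hG.prec_of hq.flip hr.flip ⟨b, a, fun x hx hr' => hq.asymm hx (ha x hr')⟩

theorem Tame.not_prec_flip (hG : Tame G) (hr : InvOrder G r) (hq : InvOrder G q) (h : Prec r q)
    (h' : Prec r (flip q)) : False := by
  obtain ⟨b, -⟩ := hG.nontriv
  obtain ⟨a, ha⟩ := h b
  obtain ⟨a', ha'⟩ := h' b
  obtain ⟨x, hx⟩ := hG.avail_singleton hr {a, a'} (by simp)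
  exact hq.asymm (ha x (hx a (by simp) r rfl)) (ha' x (hx a' (by simp) r rfl))

theorem Prec.not_avail (hG : Tame G) (hr : InvOrder G r) (hq : InvOrder G q) (h : Prec r q) :
    ¬ Avail {r, flip q} := by
  rw [hG.avail_pair_iff hr hq.flip]
  intro H
  obtain ⟨b, -⟩ := hG.nontriv
  obtain ⟨a, ha⟩ := h b
  obtain ⟨x, hx, hx'⟩ := H a b
  exact hq.asymm (ha x hx) hx'

theorem Tame.not_perp_iff (hG : Tame G) (hi : InvOrder G i) (hl : InvOrder G l) :
    ¬ Perp i l ↔ (Prec i l ∨ Prec i (flip l)) ∨ (Prec (flip i) l ∨ Prec (flip i) (flip l)) := by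
  have key : ∀ i l, InvOrder G i → InvOrder G l → (¬ Avail {i, flip l} ↔ Prec i l) :=
    fun i l hi hl => ⟨hG.prec_of_not_avail hi hl, fun h => h.not_avail hG hi hl⟩
  have h1 := key i l hi hl
  have h2 := key i (flip l) hi hl.flip
  have h3 := key (flip i) l hi.flip hl
  have h4 := key (flip i) (flip l) hi.flip hl.flip
  have e : flip (flip l) = l := rfl
  rw [e] at h2 h4
  rw [← h1, ← h2, ← h3, ← h4, Perp]
  tauto

theorem Perp.symm (h : Perp i l) : Perp l i := by
  unfold Perp at h ⊢
  simp only [Set.pair_comm l, Set.pair_comm (flip l)]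
  tauto

theorem Tame.cut_comparable (hG : Tame G) (hk : InvOrder G k) (hP : Cut G k P) (hQ : Cut G k Q) :
    (∀ a x, P a x → Q a x) ∨ ∀ a x, Q a x → P a x := by
  by_contra! ⟨⟨a, x, h1, h2⟩, b, y, h3, h4⟩
  obtain ⟨g, hg, rfl⟩ := hG.trans a b
  obtain ⟨y, rfl⟩ := g.surjective y
  rw [hQ.inv.iff hg] at h3
  rw [hP.inv.iff hg] at h4
  by_cases hxy : k x y
  · exact h2 (hQ.initial h3 hxy)
  · by_cases hxy' : x = y
    · exact h2 (hxy' ▸ h3)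
    · exact h4 (hP.initial h1 (hk.lt_of_not hxy' hxy))

theorem Tame.prec_cut (hm : InvOrder G m) (hq : InvOrder G q) :
    Cut G m fun b u => ∀ x, ¬ m u x → q x b where
  inv g hg b u H x hx := by
    obtain ⟨x, rfl⟩ := g.surjective x
    exact hq.inv g hg _ _ (H x fun h => hx (hm.inv g hg _ _ h))
  initial {b u v} H hvu x hx := H x fun h => hx (hm.trans hvu h)

theorem Tame.exists_prec_cut (hG : Tame G) (hm : InvOrder G m) (h : Prec m q) (b : Γ) :
    ∃ u, ∀ x, ¬ m u x → q x b := by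
  obtain ⟨a, ha⟩ := h b
  obtain ⟨u, hu⟩ := hG.exists_lt hm a
  exact ⟨u, fun x hx => ha x (hm.lt_of_not_of_lt hx hu)⟩

theorem Tame.prec_or_prec (hG : Tame G) (hm : InvOrder G m) (hr : InvOrder G r)
    (hq : InvOrder G q) (h : Prec m r) (h' : Prec m q) : Prec r q ∨ Prec q r := by
  have key : ∀ r q, InvOrder G r → InvOrder G q → Prec m r → (∀ b u, (∀ x, ¬ m u x → r x b) →
      ∀ x, ¬ m u x → q x b) → Prec q r := by
    intro r q hr hq h H
    obtain ⟨b, -⟩ := hG.nontriv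
    obtain ⟨u, hu⟩ := hG.exists_prec_cut hm h b
    refine hG.prec_of hq hr ⟨u, b, fun x hxu hbx => ?_⟩
    have := H x u (fun y hy => hr.trans (hu y hy) hbx) u (hm.irrefl u)
    exact hq.asymm this hxu
  rcases hG.cut_comparable hm (Tame.prec_cut hm hr) (Tame.prec_cut hm hq) with H | H
  · exact .inr (key r q hr hq h H)
  · exact .inl (key q r hq hr h' H)

end perp

/-- An invariant family of nonempty initial segments, with `P a` strictly below `a`, leaving a
nonempty gap. -/
structure LowCut (G : Subgroup (Equiv.Perm Γ)) (k P : Γ → Γ → Prop) : Prop where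
  cut : Cut G k P
  nonempty : ∀ a, ∃ x, P a x
  irrefl : ∀ a, ¬ P a a
  gap : ∀ a, ∃ y, k y a ∧ ¬ P a y

section top

variable {G : Subgroup (Equiv.Perm Γ)} {r q k l i m f P Q R : Γ → Γ → Prop}

theorem Tame.not_perp_of_prec (hG : Tame G) (hm : InvOrder G m) (hq : InvOrder G q)
    (hf : InvOrder G f) (h : Prec m q) (h' : ¬ Perp m f) : ¬ Perp q f := by
  rw [hG.not_perp_iff hm hf] at h'
  rw [hG.not_perp_iff hq hf]
  rcases h' with (h' | h') | (h' | h')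
  · rcases hG.prec_or_prec hm hq hf h h' with H | H
    · exact .inl (.inl H)
    · exact .inr (.inr (hG.prec_flip hf hq H))
  · rcases hG.prec_or_prec hm hq hf.flip h h' with H | H
    · exact .inl (.inr H)
    · exact .inr (.inl (hG.prec_flip hf.flip hq H))
  · have := (hG.prec_flip hm.flip hf h').trans h
    exact .inr (.inl (hG.prec_flip hf.flip hq this))
  · have := (hG.prec_flip hm.flip hf.flip h').trans h
    exact .inr (.inr (hG.prec_flip hf hq this))

theorem Tame.eq_of_prec_top (hG : Tame G) (hq : InvOrder G q) (hk : InvOrder G k) (ht : Top G k)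
    (h : Prec q k) : q = k := by
  have hU : Cut G k fun a u => ¬ k a u ∨ ∃ x, q x a ∧ ¬ k x u := by
    constructor
    · rintro g hg a u (H | ⟨x, hx, hxu⟩)
      · exact .inl (by rwa [hk.inv.iff hg])
      · exact .inr ⟨g x, hq.inv g hg _ _ hx, by rwa [hk.inv.iff hg]⟩
    · rintro a u v (H | ⟨x, hx, hxu⟩) hvu
      · exact .inl fun h => H (hk.trans h hvu)
      · exact .inr ⟨x, hx, fun h => hxu (hk.trans h hvu)⟩
  refine hq.eq_of_imp hk fun y a hya => ?_
  by_contra hn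
  have hall := ht _ hU (fun a => .inl (hk.irrefl a))
    ⟨a, y, hk.lt_of_not (hq.ne hya) hn, .inr ⟨y, hya, hk.irrefl y⟩⟩
  obtain ⟨c, hc⟩ := h a
  obtain ⟨u, hu⟩ := hG.avail_singleton hk.flip {a, c} (by simp)
  rcases hall c u with H | ⟨x, hx, hxu⟩
  · exact H (hu c (by simp) _ rfl)
  · exact hxu (hk.trans (hc x hx) (hu a (by simp) _ rfl))

theorem Tame.prec_or_prec_flip_of_top (hG : Tame G) (hf : InvOrder G f) (ht : Top G f)
    (hq : InvOrder G q) (h : ¬ Perp f q) : Prec f q ∨ Prec f (flip q) := by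
  rw [hG.not_perp_iff hf hq] at h
  rcases h with h | (h | h)
  · exact h
  · have := hG.eq_of_prec_top hq.flip hf ht (hG.prec_flip hf.flip hq h)
    exact .inr (this ▸ Prec.refl _)
  · have := hG.eq_of_prec_top hq hf ht (hG.prec_flip hf.flip hq.flip h)
    exact .inl (this ▸ Prec.refl _)

theorem Tame.cutLt_invOrder (hG : Tame G) (hk : InvOrder G k) (hP : Cut G k P)
    (hne : ∃ a b, CutLt P a b) : InvOrder G (CutLt P) where
  inv := by
    rintro g hg a b ⟨x, hx, hx'⟩
    exact ⟨g x, hP.inv g hg _ _ hx, by rwa [hP.inv.iff hg]⟩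
  irrefl := fun a ⟨x, hx, hx'⟩ => hx' hx
  trans := by
    rintro a b c ⟨x, hx, hx'⟩ ⟨y, hy, hy'⟩
    refine ⟨y, hy, fun h => ?_⟩
    by_cases hxy : k x y
    · exact hx' (hP.initial h hxy)
    · by_cases e : x = y
      · exact hx' (e ▸ h)
      · exact hy' (hP.initial hx (hk.lt_of_not e hxy))
  total := by
    intro a b hab
    by_contra! hcon
    obtain ⟨h1, h2⟩ := hcon
    simp only [CutLt, not_exists, not_and, not_not] at h1 h2
    have hinv : Invar G fun a b => ∀ x, P a x ↔ P b x := by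
      intro g hg a b h x
      obtain ⟨x, rfl⟩ := g.surjective x
      rw [hP.inv.iff hg, hP.inv.iff hg, h x]
    rcases hG.prim (fun a b => ∀ x, P a x ↔ P b x) hinv
      ⟨fun _ _ => Iff.rfl, fun h x => (h x).symm, fun h h' x => (h x).trans (h' x)⟩ with h | h
    · exact hab (h a b fun x => ⟨h2 x, h1 x⟩)
    · obtain ⟨a, b, x, hx, hx'⟩ := hne
      exact hx' ((h a b x).2 hx)

theorem Tame.exists_maximal_cut (hG : Tame G) (hq : InvOrder G q) (hP : Cut G q P)
    (hrefl : ∀ a, P a a) (hproper : ∀ a, ∃ x, ¬ P a x) :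
    ∃ T, Cut G q T ∧ P ≤ T ∧ (∀ a, T a a) ∧ (∀ a, ∃ x, ¬ T a x) ∧ InvOrder G (CutLt T) ∧
      Top G (CutLt T) ∧ Prec (CutLt T) q := by
  have hfin : {P | Cut G q P ∧ (∀ a, P a a) ∧ ∀ a, ∃ x, ¬ P a x}.Finite :=
    hG.fin.subset fun P hP => hP.1.inv
  obtain ⟨T, hPT, hT⟩ := hfin.exists_le_maximal (a := P) ⟨hP, hrefl, hproper⟩
  obtain ⟨hTc, hTr, hTp⟩ := hT.prop
  have hlt : ∀ {a x}, ¬ T a x → CutLt T a x := fun {a x} h => ⟨x, hTr x, h⟩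
  obtain ⟨a₀, -⟩ := hG.nontriv
  obtain ⟨x₀, hx₀⟩ := hTp a₀
  have hm : InvOrder G (CutLt T) := hG.cutLt_invOrder hq hTc ⟨a₀, x₀, hlt hx₀⟩
  refine ⟨T, hTc, hPT, hTr, hTp, hm, ?_, hG.prec_of hm hq ⟨a₀, x₀, ?_⟩⟩
  · rintro P' hP' hr ⟨a, x, ⟨y, hy, hy'⟩, hx⟩
    have hU : Cut G q fun a y => ∃ x, P' a x ∧ T x y := by
      constructor
      · rintro g hg a y ⟨x, hx, hxy⟩
        exact ⟨g x, hP'.inv g hg _ _ hx, hTc.inv g hg _ _ hxy⟩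
      · rintro a y z ⟨x, hx, hxy⟩ hzy
        exact ⟨x, hx, hTc.initial hxy hzy⟩
    have hall : ∃ a, ∀ y, ∃ x, P' a x ∧ T x y := by
      by_contra! hcon
      have hle := hT.le_of_ge (y := fun a y => ∃ x, P' a x ∧ T x y)
        ⟨hU, fun a => ⟨a, hr a, hTr a⟩, fun a => by simpa using hcon a⟩
        (fun a y h => ⟨a, hr a, h⟩)
      exact hy' (hle a y ⟨x, hx, hy⟩)
    obtain ⟨c, hc⟩ := hall
    intro a x
    have hca : ∀ y, ∃ x, P' a x ∧ T x y :=
      hG.forall_of (p := fun a => ∀ y, ∃ x, P' a x ∧ T x y) (fun g hg a h y => by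
        obtain ⟨x, hx, hxy⟩ := h (g⁻¹ y)
        exact ⟨g x, hP'.inv g hg _ _ hx, by simpa using hTc.inv g hg _ _ hxy⟩) hc a
    obtain ⟨z, hz⟩ := hTp x
    obtain ⟨x', hx', hxz⟩ := hca z
    exact hP'.initial hx' ⟨z, hxz, hz⟩
  · rintro x ⟨w, hw, hw'⟩ hbx
    refine hw' (hTc.initial (hTr x) ?_)
    by_cases e : w = x₀
    · exact e ▸ hbx
    · exact hq.trans (hq.lt_of_not (Ne.symm e) fun h => hx₀ (hTc.initial hw h)) hbx

theorem Tame.exists_top_prec (hG : Tame G) (hq : InvOrder G q) :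
    ∃ m, InvOrder G m ∧ Top G m ∧ Prec m q := by
  obtain ⟨T, -, -, -, -, h⟩ := hG.exists_maximal_cut (P := fun a x => ¬ q a x) hq ⟨fun g hg a x h =>
    by rwa [hq.inv.iff hg], fun h hyx h' => h (hq.trans h' hyx)⟩ hq.irrefl
    (fun a => by simpa using hG.exists_gt hq a)
  exact ⟨_, h⟩

theorem Tame.eq_or_of_prec (hG : Tame G) (hk : InvOrder G k)
    (hP : Maximal (LowCut G k) P) (hq : InvOrder G q) (h : Prec k q) :
    q = k ∨ ∀ b, ∃ u, ∀ x, ¬ P x u → q x b := by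
  have hQ := Tame.prec_cut hk hq
  by_cases hgap : ∃ a y, k y a ∧ ¬ ∀ x, ¬ k y x → q x a
  · have hlow : LowCut G k fun b u => ∀ x, ¬ k u x → q x b :=
      ⟨hQ, hG.exists_prec_cut hk h, fun a h => hq.irrefl a (h a (hk.irrefl a)), by
        obtain ⟨a, y, h⟩ := hgap
        exact hG.forall_of (p := fun a => ∃ y, k y a ∧ ¬ ∀ x, ¬ k y x → q x a)
          (fun g hg a ⟨y, h1, h2⟩ => ⟨g y, hk.inv g hg _ _ h1, by rwa [hQ.inv.iff hg]⟩) ⟨y, h⟩⟩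
    have hle : ∀ b u, (∀ x, ¬ k u x → q x b) → P b u := by
      rcases hG.cut_comparable hk hP.prop.cut hQ with H | H
      · exact hP.le_of_ge (y := fun b u => ∀ x, ¬ k u x → q x b) hlow H
      · exact H
    refine .inr fun b => ?_
    obtain ⟨u, hu⟩ := hG.exists_prec_cut hk h b
    refine ⟨u, fun x hx => ?_⟩
    have : ¬ ∀ y, ¬ k u y → q y x := fun h => hx (hle x u h)
    push Not at this
    obtain ⟨y, hy, hyx⟩ := this
    exact hq.lt_of_not_of_lt hyx (hu y hy)
  · push Not at hgap
    exact .inl (hk.eq_of_imp hq fun y a hya => hgap a y hya y (hk.irrefl y)).symm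

theorem Tame.avail_of_prec (hG : Tame G) {F S : Set (Γ → Γ → Prop)} (hF : Avail F)
    (hS : ∀ q ∈ S, InvOrder G q) (h : ∀ q ∈ S, ∃ f ∈ F, Prec f q) : Avail S := by
  intro B hB
  have hfin : S.Finite := hG.finite_orders.subset hS
  have key : ∀ q : S, ∃ a, ∃ f ∈ F, ∀ x, f x a → ∀ b ∈ B, q.1 x b := by
    rintro ⟨q, hq⟩
    obtain ⟨b, hb⟩ := hG.avail_singleton (hS q hq) B hB
    obtain ⟨f, hf, hfq⟩ := h q hq
    obtain ⟨a, ha⟩ := hfq b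
    exact ⟨a, f, hf, fun x hx c hc => (hS q hq).trans (ha x hx) (hb c hc _ rfl)⟩
  choose a ha using key
  have := hfin.to_subtype
  obtain ⟨x, hx⟩ := hF (Set.range a) (Set.finite_range a)
  refine ⟨x, fun b hb q hq => ?_⟩
  obtain ⟨f, hf, H⟩ := ha ⟨q, hq⟩
  exact H x (hx _ ⟨_, rfl⟩ f hf) b hb

end top

/-- A family of pairwise independent top orders, independent of `k`, controlling all the orders
independent of `k`. -/
structure Fam (G : Subgroup (Equiv.Perm Γ)) (k : Γ → Γ → Prop) (F : Set (Γ → Γ → Prop)) :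
    Prop where
  top : ∀ f ∈ F, InvOrder G f ∧ Top G f
  pairwise : F.Pairwise Perp
  perp : ∀ f ∈ F, Perp f k
  cov : ∀ q, InvOrder G q → Perp k q → ∃ f ∈ F, ¬ Perp f q

/-- The orders forced downwards by going down along `F`. -/
def forced (G : Subgroup (Equiv.Perm Γ)) (F : Set (Γ → Γ → Prop)) : Set (Γ → Γ → Prop) :=
  {q | InvOrder G q ∧ ∃ f ∈ F, Prec f q}

/-- The orders independent of `k` which are forced downwards by going down along `F`. -/
def forcedPerp (G : Subgroup (Equiv.Perm Γ)) (k : Γ → Γ → Prop) (F : Set (Γ → Γ → Prop)) :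
    Set (Γ → Γ → Prop) :=
  {q | q ∈ forced G F ∧ Perp k q}

section family

variable {G : Subgroup (Equiv.Perm Γ)} {r q k l i m f P Q R : Γ → Γ → Prop}
  {F F' S : Set (Γ → Γ → Prop)}

theorem perp_flip_left : Perp (flip i) l ↔ Perp i l := by
  have : flip (flip i) = i := rfl
  simp only [Perp, this]
  tauto

theorem perp_flip_right : Perp i (flip l) ↔ Perp i l := by
  have : flip (flip l) = l := rfl
  simp only [Perp, this]
  tauto

theorem Prec.not_perp (hG : Tame G) (hr : InvOrder G r) (hq : InvOrder G q) (h : Prec r q) :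
    ¬ Perp r q :=
  (hG.not_perp_iff hr hq).2 (.inl (.inl h))

theorem Good.not_flip_mem (hG : Tame G) (hS : Good G S) (hr : r ∈ S) : flip r ∉ S := by
  intro hr'
  obtain ⟨a, -⟩ := hG.nontriv
  obtain ⟨b, hb⟩ := hS.exists_below hG a
  exact (hS.ord r hr).asymm (hb r hr) (hb _ hr')

theorem Tame.exists_fam (hG : Tame G) (hk : InvOrder G k) : ∃ F, Fam G k F := by
  have hfin : {F : Set (Γ → Γ → Prop) | (∀ f ∈ F, InvOrder G f ∧ Top G f) ∧ F.Pairwise Perp ∧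
      ∀ f ∈ F, Perp f k}.Finite :=
    hG.finite_orders.finite_subsets.subset fun F hF f hf => (hF.1 f hf).1
  obtain ⟨F, -, hF⟩ := hfin.exists_le_maximal (a := ∅) (by simp)
  obtain ⟨h1, h2, h3⟩ := hF.prop
  refine ⟨F, h1, h2, h3, fun q hq hkq => ?_⟩
  by_contra! hcon
  obtain ⟨m, hm, hmt, hmq⟩ := hG.exists_top_prec hq
  have hmk : Perp m k := by
    by_contra h
    exact hG.not_perp_of_prec hm hq hk hmq h hkq.symm
  have hmf : ∀ f ∈ F, Perp f m := by
    intro f hf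
    by_contra h
    exact hG.not_perp_of_prec hm hq (h1 f hf).1 hmq (fun h' => h h'.symm) (hcon f hf).symm
  have hmem : m ∈ F := hF.le_of_ge (y := insert m F)
    ⟨by rintro f (rfl | hf); exacts [⟨hm, hmt⟩, h1 f hf],
      h2.insert fun f hf _ => ⟨(hmf f hf).symm, hmf f hf⟩,
      by rintro f (rfl | hf); exacts [hmk, h3 f hf]⟩ (Set.subset_insert _ _) (Set.mem_insert _ _)
  exact hmq.not_perp hG hm hq (hcon m hmem)

theorem Fam.exists_opposite (hG : Tame G) (hk : InvOrder G k) (hF : Fam G k F) :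
    ∃ F', Fam G k F' ∧ ∀ f' ∈ F', ∃ f ∈ F, Prec f' (flip f) := by
  have H : ∀ f : F, ∃ m, InvOrder G m ∧ Top G m ∧ Prec m (flip f.1) := fun f =>
    hG.exists_top_prec (hF.top f f.2).1.flip
  choose m hm hmt hmf using H
  refine ⟨Set.range m, ⟨?_, ?_, ?_, ?_⟩, ?_⟩
  · rintro _ ⟨f, rfl⟩
    exact ⟨hm f, hmt f⟩
  · rintro _ ⟨f, rfl⟩ _ ⟨g, rfl⟩ hne
    by_contra hn
    have hf := (hF.top f f.2).1
    have hg := (hF.top g g.2).1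
    have h1 := hG.not_perp_of_prec (hm f) hf.flip (hm g) (hmf f) hn
    have h2 := hG.not_perp_of_prec (hm g) hg.flip hf.flip (hmf g) fun h => h1 h.symm
    rw [perp_flip_left, perp_flip_right] at h2
    exact h2 (hF.pairwise g.2 f.2 fun e => hne (by rw [Subtype.ext e]))
  · rintro _ ⟨f, rfl⟩
    by_contra hn
    have h1 := hG.not_perp_of_prec (hm f) (hF.top f f.2).1.flip hk (hmf f) hn
    rw [perp_flip_left] at h1
    exact h1 (hF.perp f f.2)
  · intro q hq hkq
    obtain ⟨f, hf, hfq⟩ := hF.cov q hq hkq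
    have h1 := hG.prec_flip (hm ⟨f, hf⟩) (hF.top f hf).1.flip (hmf ⟨f, hf⟩)
    have h2 := hG.not_perp_of_prec (hF.top f hf).1 (hm ⟨f, hf⟩).flip hq h1 hfq
    rw [perp_flip_left] at h2
    exact ⟨_, ⟨⟨f, hf⟩, rfl⟩, h2⟩
  · rintro _ ⟨f, rfl⟩
    exact ⟨f, f.2, hmf f⟩

theorem Fam.finite (hG : Tame G) (hF : Fam G k F) : F.Finite :=
  hG.finite_orders.subset fun f hf => (hF.top f hf).1

theorem Fam.avail_insert (hG : Tame G) (hF : Fam G k F) (hl : InvOrder G l)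
    (h : ∀ f ∈ F, Perp f l) : Avail (insert l (forcedPerp G k F)) := by
  refine hG.avail_of_prec (hG.avail_insert_of_perp (hF.finite hG) hF.top hF.pairwise hl h) ?_ ?_
  · rintro q (rfl | hq)
    exacts [hl, hq.1.1]
  · rintro q (rfl | ⟨⟨-, f, hf, hfq⟩, -⟩)
    exacts [⟨q, .inl rfl, Prec.refl q⟩, ⟨f, .inr hf, hfq⟩]

theorem Fam.good (hG : Tame G) (hF : Fam G k F) (hk : InvOrder G k) (ht : Top G k) :
    Good G (forced G (insert k F)) where
  ord r hr := hr.1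
  avail := hG.avail_of_prec
    (hG.avail_insert_of_perp (hF.finite hG) hF.top hF.pairwise hk hF.perp)
    (fun q hq => hq.1) (fun q hq => hq.2)
  full q hq := by
    by_cases h : Perp k q
    · obtain ⟨f, hf, hfq⟩ := hF.cov q hq h
      rcases hG.prec_or_prec_flip_of_top (hF.top f hf).1 (hF.top f hf).2 hq hfq with h | h
      · exact .inl ⟨hq, f, .inr hf, h⟩
      · exact .inr ⟨hq.flip, f, .inr hf, h⟩
    · rcases hG.prec_or_prec_flip_of_top hk ht hq h with h | h
      · exact .inl ⟨hq, k, .inl rfl, h⟩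
      · exact .inr ⟨hq.flip, k, .inl rfl, h⟩

theorem forcedPerp_subset : forcedPerp G k F ⊆ forced G (insert k F) :=
  fun _ ⟨⟨h, f, hf, hfq⟩, _⟩ => ⟨h, f, .inr hf, hfq⟩

theorem Fam.flip_mem_of_opposite (hG : Tame G) (hF : Fam G k F) (hF' : Fam G k F')
    (hop : ∀ f' ∈ F', ∃ f ∈ F, Prec f' (flip f)) (hq : q ∈ forcedPerp G k F') :
    flip q ∈ forcedPerp G k F := by
  obtain ⟨⟨hq, f', hf', hf'q⟩, hkq⟩ := hq
  have ho' := (hF'.top f' hf').1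
  obtain ⟨f, hf, hfq⟩ := hF.cov q hq hkq
  have ho := (hF.top f hf).1
  rcases hG.prec_or_prec_flip_of_top ho (hF.top f hf).2 hq hfq with h | h
  · exfalso
    obtain ⟨f₂, hf₂, hf'f₂⟩ := hop f' hf'
    have hcomp : Prec f f' ∨ Prec f' f := by
      rcases hG.prec_or_prec hq.flip ho.flip ho'.flip (hG.prec_flip ho hq h)
        (hG.prec_flip ho' hq hf'q) with h | h
      · exact .inr (hG.prec_flip ho.flip ho'.flip h)
      · exact .inl (hG.prec_flip ho'.flip ho.flip h)
    have hn : ¬ Perp f' f := by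
      rcases hcomp with h | h
      · exact fun hp => h.not_perp hG ho ho' hp.symm
      · exact h.not_perp hG ho' ho
    have h2 := hG.not_perp_of_prec ho' (hF.top f₂ hf₂).1.flip ho hf'f₂ hn
    rw [perp_flip_left] at h2
    have e : f₂ = f := by
      by_contra hne
      exact h2 (hF.pairwise hf₂ hf hne)
    subst e
    rcases hcomp with h | h
    · exact hG.not_prec_flip ho ho (Prec.refl _) (h.trans hf'f₂)
    · exact hG.not_prec_flip ho' ho h hf'f₂
  · exact ⟨⟨hq.flip, f, hf, h⟩, perp_flip_right.2 hkq⟩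

theorem Fam.not_cutLt (hG : Tame G) (hF : Fam G k F) (hk : InvOrder G k) (ht : Top G k)
    (hP : Maximal (LowCut G k) P) {d a : Γ} (h1 : Below (forcedPerp G k F) d a) (h2 : k a d) :
    ¬ CutLt P d a := by
  intro h3
  have hgood := hF.good hG hk ht
  obtain ⟨hPc, hPn, hPi, hPg⟩ := hP.prop
  have hk' : k ∈ forced G (insert k F) := ⟨hk, k, .inl rfl, Prec.refl _⟩
  have hR : ∀ d d', Below (forced G (insert k F)) d d' → P d' d := by
    intro d d' hd
    obtain ⟨u, hu⟩ := hPn d'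
    obtain ⟨e, he⟩ := hgood.avail {d', u} (by simp)
    obtain ⟨g, hg, rfl, hgd⟩ := hgood.conj_pair hG (he d' (by simp)) hd
    rw [← hgd]
    exact hPc.inv g hg _ _ (hPc.initial (x := u) (by simpa using hu) (he u (by simp) k hk'))
  obtain ⟨y, hy, hy'⟩ := hPg d
  have hu : ∀ q : forced G (insert k F), ∃ u, Prec k q.1 → q.1 ≠ k → ∀ x, ¬ P x u → q.1 x d := by
    rintro ⟨q, hq⟩
    by_cases h : Prec k q
    · rcases hG.eq_or_of_prec hk hP hq.1 h with h | h
      · exact ⟨d, fun _ h' => (h' h).elim⟩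
      · exact (h d).imp fun u hu _ _ => hu
    · exact ⟨d, fun h' => (h h').elim⟩
  choose u hu using hu
  have hfin : (forced G (insert k F)).Finite := hG.finite_orders.subset hgood.ord
  have := hfin.to_subtype
  obtain ⟨e, he⟩ := hgood.avail (insert y (insert d (Set.range u)))
    (((Set.finite_range u).insert d).insert y)
  have hW : Invar G fun a x => Below (forcedPerp G k F) x a ∧ CutLt P x a := by
    rintro g hg a x ⟨h, v, hv, hv'⟩
    exact ⟨h.map (fun r hr => hr.1.1) hg, g v, hPc.inv g hg _ _ hv, by rwa [hPc.inv.iff hg]⟩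
  obtain ⟨x, hyx, hxd, hxe, v, hv, hv'⟩ := hgood.dense hG hk' ht hW ⟨a, d, h2, h1, h3⟩
    (he y (by simp)) (he d (by simp)) hy
  refine hy' (hPc.initial (hR x d fun q hq => ?_) hyx)
  by_cases hkq : Perp k q
  · have hmem : q ∈ forcedPerp G k F := by
      obtain ⟨hq, f, rfl | hf, h⟩ := hq
      · exact (h.not_perp hG hk hq hkq).elim
      · exact ⟨⟨hq, f, hf, h⟩, hkq⟩
    exact hq.1.trans (hxe q hmem) (he d (by simp) q hq)
  · have hprec : Prec k q := by
      refine (hG.prec_or_prec_flip_of_top hk ht hq.1 hkq).resolve_right fun h => ?_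
      exact hgood.not_flip_mem hG hq ⟨hq.1.flip, k, .inl rfl, h⟩
    by_cases e' : q = k
    · rwa [e']
    · refine hu ⟨q, hq⟩ hprec e' x fun hPx => ?_
      have heu : k e (u ⟨q, hq⟩) := he _ (by simp) k hk'
      have huv : ¬ k v (u ⟨q, hq⟩) := fun h => hv' (hPc.initial hPx h)
      by_cases e'' : v = u ⟨q, hq⟩
      · exact hv' (e'' ▸ hPx)
      · exact hPi e (hPc.initial (hPc.initial hv (hk.lt_of_not e'' huv)) heu)

theorem Fam.exists_cutLt (hG : Tame G) (hF : Fam G k F) (hk : InvOrder G k) (ht : Top G k)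
    (hP : LowCut G k P) :
    (∃ d a, Below (forcedPerp G k F) d a ∧ k a d ∧ CutLt P d a) ∨
      ∃ d a, Below (forcedPerp G k F) d a ∧ k d a ∧ CutLt P a d := by
  have hgood := hF.good hG hk ht
  have hk' : k ∈ forced G (insert k F) := ⟨hk, k, .inl rfl, Prec.refl _⟩
  have hN : ∀ r ∈ forcedPerp G k F, InvOrder G r := fun r hr => hr.1.1
  obtain ⟨a, -⟩ := hG.nontriv
  by_cases hgap : ∃ u v, k u v ∧ ∀ B : Set Γ, B.Finite →
      ∃ d, (∀ b ∈ B, Below (forcedPerp G k F) d b) ∧ ¬ P d u ∧ k v d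
  · left
    have hall := ht (fun u v => k u v → ∀ B : Set Γ, B.Finite →
      ∃ d, (∀ b ∈ B, Below (forcedPerp G k F) d b) ∧ ¬ P d u ∧ k v d) ⟨?_, ?_⟩
      (fun a h => (hk.irrefl a h).elim)
      (by obtain ⟨u, v, h, h'⟩ := hgap; exact ⟨u, v, h, fun _ => h'⟩)
    · obtain ⟨u, hu⟩ := hP.nonempty a
      have hua : k u a := by
        by_contra h
        by_cases e : u = a
        · exact hP.irrefl a (by rwa [e] at hu)
        · exact hP.irrefl a (hP.cut.initial hu (hk.lt_of_not e h))
      obtain ⟨d, hd, hdu, had⟩ := hall u a hua {a} (by simp)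
      exact ⟨d, a, hd a rfl, had, u, hu, hdu⟩
    · intro g hg u v H huv B hB
      obtain ⟨d, hd, hdu, hvd⟩ := H ((hk.inv.iff hg _ _).1 huv) (g ⁻¹' B)
        (hB.preimage g.injective.injOn)
      refine ⟨g d, fun b hb => ?_, by rwa [hP.cut.inv.iff hg], hk.inv g hg _ _ hvd⟩
      obtain ⟨b, rfl⟩ := g.surjective b
      exact (hd b hb).map hN hg
    · intro u v v' H hv huv B hB
      obtain ⟨d, hd, hdu, hvd⟩ := H (hk.trans huv hv) B hB
      exact ⟨d, hd, hdu, hk.trans hv hvd⟩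
  · right
    push Not at hgap
    obtain ⟨y, hya, hy⟩ := hP.gap a
    obtain ⟨e, he⟩ := hgood.avail {y, a} (by simp)
    obtain ⟨v, hyv, hva, -⟩ := hgood.dense hG hk' ht (W := fun _ _ => True)
      (fun _ _ _ _ _ => trivial) ⟨y, a, hya, trivial⟩ (he y (by simp)) (he a (by simp)) hya
    obtain ⟨B, hB, hnon⟩ := hgap y v hyv
    obtain ⟨e, he⟩ := hgood.avail (insert v (insert a B)) ((hB.insert a).insert v)
    obtain ⟨x, hvx, hxa, hxe⟩ := hgood.dense hG hk' ht
      (W := fun a x => Below (forcedPerp G k F) x a) (fun g hg a x h => h.map hN hg)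
      (by
        obtain ⟨x, hx⟩ := hF.avail_insert hG hk.flip
          (fun f hf => perp_flip_right.2 (hF.perp f hf)) {a} (by simp)
        exact ⟨a, x, hx a rfl _ (.inl rfl), fun r hr => hx a rfl r (.inr hr)⟩)
      (he v (by simp)) (he a (by simp)) hva
    have hxB : ∀ b ∈ insert a B, Below (forcedPerp G k F) x b := fun b hb r hr =>
      (hN r hr).trans (hxe r hr) (he b (.inr hb) r (forcedPerp_subset hr))
    refine ⟨x, a, hxB a (by simp), hxa, y, ?_, hy⟩
    by_contra hxy
    exact hnon x (fun b hb => hxB b (.inr hb)) hxy hvx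

theorem Tame.not_lowCut (hG : Tame G) (hk : InvOrder G k) (ht : Top G k) : ¬ LowCut G k P := by
  intro hP
  have hfin : {P | LowCut G k P}.Finite := hG.fin.subset fun P hP => hP.cut.inv
  obtain ⟨P, -, hP⟩ := hfin.exists_le_maximal hP
  obtain ⟨F, hF⟩ := hG.exists_fam hk
  rcases hF.exists_cutLt hG hk ht hP.prop with ⟨d, a, h1, h2, h3⟩ | ⟨d, a, h1, h2, h3⟩
  · exact hF.not_cutLt hG hk ht hP h1 h2 h3
  · obtain ⟨F', hF', hop⟩ := hF.exists_opposite hG hk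
    exact hF'.not_cutLt hG hk ht hP
      (fun q hq => h1 (flip q) (hF.flip_mem_of_opposite hG hF' hop hq)) h2 h3

/-- Every invariant order is top. -/
theorem Tame.top (hG : Tame G) (hq : InvOrder G q) : Top G q := by
  intro P hP hrefl ⟨a, x, hax, hPax⟩
  by_contra! hcon
  obtain ⟨b, hb⟩ := hcon
  have hproper := hG.forall_of (p := fun a => ∃ x, ¬ P a x)
    (fun g hg a ⟨x, hx⟩ => ⟨g x, by rwa [hP.inv.iff hg]⟩) hb
  obtain ⟨T, hT, hPT, hTr, hTp, hm, hmt, -⟩ := hG.exists_maximal_cut hq hP hrefl hproper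
  have hD : Cut G (CutLt T) fun a x => ¬ T x a := by
    constructor
    · intro g hg a x h
      rwa [hT.inv.iff hg]
    · rintro a x y h ⟨w, hw, hw'⟩ hy
      by_cases e : w = a
      · exact h (e ▸ hw)
      · by_cases hwa : q w a
        · exact hw' (hT.initial hy hwa)
        · exact h (hT.initial hw (hq.lt_of_not e hwa))
  refine hG.not_lowCut hm hmt ⟨hD, ?_, fun a h => h (hTr a), ?_⟩
  · obtain ⟨x, hx⟩ := hTp a
    exact hG.forall_of (p := fun a => ∃ x, ¬ T x a)
      (fun g hg a ⟨x, hx⟩ => ⟨g x, by rwa [hT.inv.iff hg]⟩) ⟨a, hx⟩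
  · have hex : ∃ a y, CutLt T y a ∧ ¬ ¬ T y a := by
      have h1 : T a x := hPT a x hPax
      rcases hm.total (hq.ne hax) with h | h
      · exact ⟨x, a, h, not_not.2 h1⟩
      · exact ⟨a, x, h, not_not.2 (hT.initial (hTr x) hax)⟩
    obtain ⟨c, hc⟩ := hex
    exact hG.forall_of (p := fun a => ∃ y, CutLt T y a ∧ ¬ ¬ T y a)
      (fun g hg a ⟨y, h, h'⟩ => ⟨g y, hm.inv g hg _ _ h, by rwa [hT.inv.iff hg]⟩) hc

theorem Tame.perp_of_ne (hG : Tame G) (hi : InvOrder G i) (hl : InvOrder G l) (h1 : i ≠ l)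
    (h2 : i ≠ flip l) : Perp i l := by
  by_contra h
  rcases hG.prec_or_prec_flip_of_top hi (hG.top hi) hl h with h | h
  · exact h1 (hG.eq_of_prec_top hi hl (hG.top hl) h)
  · exact h2 (hG.eq_of_prec_top hi hl.flip (hG.top hl.flip) h)

end family

end OrderedAction

namespace OrderedAction

universe u

variable {Γ : Type u} {ι : Type*}

/-- Pairwise independent invariant orders determining the orbits on finite tuples. -/
structure Indep (G : Subgroup (Equiv.Perm Γ)) (o : ι → Γ → Γ → Prop) : Prop where
  tame : Tame G
  ord : ∀ i, InvOrder G (o i)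
  perp : ∀ i j, i ≠ j → Perp (o i) (o j)
  hom : ∀ {κ : Type u} [Finite κ] (x y : κ → Γ),
    (∀ i a b, o i (x a) (x b) ↔ o i (y a) (y b)) → ∃ g ∈ G, ∀ a, g (x a) = y a

/-- The points outside of `A` whose position relative to `A` is given by `L`. -/
def Box (o : ι → Γ → Γ → Prop) (A : Finset Γ) (L : ι → Γ → Prop) (x : Γ) : Prop :=
  x ∉ A ∧ ∀ i, ∀ a ∈ A, (o i a x ↔ L i a)

/-- The sets `L i` are initial segments on `A`. -/
def ValidCut (o : ι → Γ → Γ → Prop) (A : Finset Γ) (L : ι → Γ → Prop) : Prop :=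
  ∀ i, ∀ a ∈ A, ∀ b ∈ A, o i a b → L i b → L i a

/-- All the valid cuts over `A` are realized by copies of all finite sets. -/
def Full (G : Subgroup (Equiv.Perm Γ)) (o : ι → Γ → Γ → Prop) (A : Finset Γ) : Prop :=
  ∀ L, ValidCut o A L → ∀ F : Set Γ, F.Finite → ∃ g ∈ G, ∀ x ∈ F, Box o A L (g x)

/-- The relation on `Γ` induced by a relation on a subset `Y`. -/
def Transfer (G : Subgroup (Equiv.Perm Γ)) (Y : Γ → Prop) (R : Γ → Γ → Prop) (b c : Γ) : Prop :=
  ∃ g ∈ G, Y (g b) ∧ Y (g c) ∧ R (g b) (g c)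

section generic

variable {G : Subgroup (Equiv.Perm Γ)} {o s : ι → Γ → Γ → Prop} {r R : Γ → Γ → Prop}
  {A : Finset Γ} {L M : ι → Γ → Prop} {i : ι} {Y : Γ → Prop}

theorem Transfer.invar : Invar G (Transfer G Y R) := by
  rintro h hh b c ⟨g, hg, h1, h2, h3⟩
  exact ⟨g * h⁻¹, G.mul_mem hg (G.inv_mem hh), by simpa, by simpa, by simpa⟩

theorem Indep.dir (hG : Indep G o) (hr : r = o i ∨ r = flip (o i)) : InvOrder G r := by
  rcases hr with rfl | rfl
  exacts [hG.ord i, (hG.ord i).flip]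

theorem Indep.corner [Finite ι] (hG : Indep G o) (hs : ∀ i, s i = o i ∨ s i = flip (o i))
    {B : Set Γ} (hB : B.Finite) : ∃ x, ∀ b ∈ B, ∀ i, s i x b := by
  have h := hG.tame.avail_of_perp (F := Set.range s) (Set.finite_range s) ?_ ?_
  · obtain ⟨x, hx⟩ := h B hB
    exact ⟨x, fun b hb i => hx b hb _ ⟨i, rfl⟩⟩
  · rintro _ ⟨i, rfl⟩
    exact ⟨hG.dir (hs i), hG.tame.top (hG.dir (hs i))⟩
  · rintro _ ⟨i, rfl⟩ _ ⟨j, rfl⟩ hne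
    have hp := hG.perp i j fun e => hne (by rw [e])
    rcases hs i with h | h <;> rcases hs j with h' | h' <;> rw [h, h'] <;>
      simpa only [perp_flip_left, perp_flip_right] using hp

theorem Box.map (hG : Indep G o) {x : Γ} (hx : Box o A L x) {g : Equiv.Perm Γ} (hg : g ∈ G)
    (hA : ∀ a ∈ A, g a = a) : Box o A L (g x) := by
  refine ⟨fun h => hx.1 ?_, fun i a ha => ?_⟩
  · have := hA _ h
    rw [g.injective.eq_iff] at this
    rwa [this] at h
  · have := (hG.ord i).inv.iff hg a x
    rwa [hA a ha, hx.2 i a ha] at this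

theorem Box.lt_iff (hG : Indep G o) {x y a : Γ} (hx : Box o A L x) (hy : Box o A M y)
    (ha : a ∈ A) (hLM : ∀ a ∈ A, (L i a ↔ M i a)) : (o i a x ↔ o i a y) ∧ (o i x a ↔ o i y a) := by
  have h : o i a x ↔ o i a y := by rw [hx.2 i a ha, hy.2 i a ha, hLM a ha]
  have key : ∀ z, z ∉ A → (o i z a ↔ ¬ o i a z) := fun z hz =>
    ⟨fun h => (hG.ord i).asymm h, fun h => (hG.ord i).lt_of_not (fun e => hz (e ▸ ha)) h⟩
  exact ⟨h, by rw [key x hx.1, key y hy.1, h]⟩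

theorem Box.conj (hG : Indep G o) {x y x' y' : Γ} (hx : Box o A L x) (hy : Box o A M y)
    (hx' : Box o A L x') (hy' : Box o A M y')
    (h : ∀ i, (o i x y ↔ o i x' y') ∧ (o i y x ↔ o i y' x')) :
    ∃ g ∈ G, (∀ a ∈ A, g a = a) ∧ g x = x' ∧ g y = y' := by
  obtain ⟨g, hg, H⟩ := hG.hom (κ := A ⊕ Bool)
    (Sum.elim (fun a => a.1) fun b => cond b x y) (Sum.elim (fun a => a.1) fun b => cond b x' y') <| by
    have hirr := fun i => (hG.ord i).irrefl
    rintro i (⟨a, ha⟩ | _ | _) (⟨b, hb⟩ | _ | _) <;>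
      simp [hx.lt_iff hG hx' (i := i), hy.lt_iff hG hy' (i := i), *]
  exact ⟨g, hg, fun a ha => H (.inl ⟨a, ha⟩), H (.inr true), H (.inr false)⟩

theorem Box.conj_point (hG : Indep G o) {x x' : Γ} (hx : Box o A L x) (hx' : Box o A L x') :
    ∃ g ∈ G, (∀ a ∈ A, g a = a) ∧ g x = x' := by
  obtain ⟨g, hg, h, h', -⟩ := hx.conj hG hx hx' hx' fun i =>
    ⟨iff_of_false ((hG.ord i).irrefl _) ((hG.ord i).irrefl _),
      iff_of_false ((hG.ord i).irrefl _) ((hG.ord i).irrefl _)⟩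
  exact ⟨g, hg, h, h'⟩

theorem Transfer.of (hG : Indep G o)
    (hR : ∀ g ∈ G, (∀ a ∈ A, g a = a) → ∀ x y, R x y → R (g x) (g y)) {b c : Γ}
    (hb : Box o A L b) (hc : Box o A L c) (h : Transfer G (Box o A L) R b c) : R b c := by
  obtain ⟨g, hg, hgb, hgc, H⟩ := h
  obtain ⟨h, hh, hA, h1, h2⟩ := hgb.conj hG hgc hb hc fun i =>
    ⟨(hG.ord i).inv.iff hg _ _, (hG.ord i).inv.iff hg _ _⟩
  simpa [h1, h2] using hR h hh hA _ _ H

/-- The cut just before `a` in the direction `r`. -/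
theorem Indep.exists_adjacent_cut (hG : Indep G o) (hr : r = o i ∨ r = flip (o i)) (a : Γ) :
    ∃ t : Γ → Prop, (∀ x y, o i x y → t y → t x) ∧ (∀ c, c ≠ a → (t c ↔ o i c a)) ∧
      ∀ x, x ≠ a → (o i a x ↔ t a) → r x a := by
  have h := hG.ord i
  rcases hr with rfl | rfl
  · exact ⟨fun c => o i c a, fun x y => h.trans, fun c _ => Iff.rfl, fun x hx H =>
      h.lt_of_not hx.symm fun h' => h.irrefl _ (H.1 h')⟩
  · exact ⟨fun c => ¬ o i a c, fun x y hxy hy hx => hy (h.trans hx hxy),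
      fun c hc => ⟨fun h' => h.lt_of_not hc.symm h', h.asymm⟩, fun x hx H => H.2 (h.irrefl a)⟩

end generic

section boxes

variable {G : Subgroup (Equiv.Perm Γ)} {o s : ι → Γ → Γ → Prop} {r R : Γ → Γ → Prop}
  {A B : Finset Γ} {L M : ι → Γ → Prop} {i : ι} {Y : Γ → Prop}

theorem InvOrder.exists_max (hr : InvOrder G r) (hA : A.Nonempty) :
    ∃ a ∈ A, ∀ c ∈ A, c ≠ a → r c a := by
  classical
  induction hA using Finset.Nonempty.cons_induction with
  | singleton a => exact ⟨a, by simp, fun c hc hca => (hca (by simpa using hc)).elim⟩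
  | cons b A hb hA ih =>
    obtain ⟨a, ha, H⟩ := ih
    have hab : a ≠ b := fun e => hb (e ▸ ha)
    by_cases h : r a b
    · refine ⟨b, by simp, fun c hc hcb => ?_⟩
      rw [Finset.mem_cons] at hc
      by_cases e : c = a
      · rwa [e]
      · exact hr.trans (H c (hc.resolve_left hcb) e) h
    · refine ⟨a, by simp [ha], fun c hc hca => ?_⟩
      rw [Finset.mem_cons] at hc
      rcases hc with rfl | hc
      · exact hr.lt_of_not hab h
      · exact H c hc hca

theorem Full.exists_box (hG : Indep G o) (hA : Full G o A) (hL : ValidCut o A L) :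
    ∃ x, Box o A L x := by
  obtain ⟨a, -⟩ := hG.tame.nontriv
  obtain ⟨g, -, hg⟩ := hA L hL {a} (by simp)
  exact ⟨g a, hg a rfl⟩

theorem Indep.lt_of_iff (hG : Indep G o) (hr : r = o i ∨ r = flip (o i)) {x y x' y' : Γ}
    (hne : x' ≠ y') (h : o i x y ↔ o i x' y') (hxy : r x y) : r x' y' := by
  rcases hr with rfl | rfl
  · exact h.1 hxy
  · exact (hG.ord i).lt_of_not hne fun H => (hG.ord i).asymm (h.2 H) hxy

theorem Indep.exists_not_lt [Finite ι] [DecidableEq Γ] (hG : Indep G o) {a : Γ} (ha : a ∈ A)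
    (hA : Full G o A) (hA₁ : Full G o (A.erase a)) (hL : ValidCut o A L) (hM : ValidCut o A M)
    (hr : r = o i ∨ r = flip (o i)) (hLa : ∀ x, Box o A L x → r a x)
    (hadj : ∀ c ∈ A, c ≠ a → (M i c ↔ o i c a)) :
    ∃ x y, Box o A L x ∧ Box o A M y ∧ ¬ r x y := by
  classical
  by_contra! hcon
  have ho := hG.dir hr
  have hsub : A.erase a ⊆ A := Finset.erase_subset _ _
  have hfix : ∀ {h : Equiv.Perm Γ}, (∀ c ∈ A.erase a, h c = c) → h a = a → ∀ c ∈ A, h c = c := by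
    intro h h1 h2 c hc
    by_cases e : c = a
    · rwa [e]
    · exact h1 c (Finset.mem_erase.2 ⟨e, hc⟩)
  have hrestr : ∀ {N x}, Box o A N x → Box o (A.erase a) N x := fun hx =>
    ⟨fun h => hx.1 (hsub h), fun i c hc => hx.2 i c (hsub hc)⟩
  set V := Box o (A.erase a) fun j c => o j c a with hV
  have hVa : V a := ⟨by simp, fun _ _ _ => Iff.rfl⟩
  have hVfull : ∀ F : Set Γ, F.Finite → ∃ g ∈ G, ∀ x ∈ F, V (g x) :=
    hA₁ _ fun j b _ c _ hbc hc => (hG.ord j).trans hbc hc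
  set R : Γ → Γ → Prop := fun u w => ∃ h ∈ G, (∀ c ∈ A.erase a, h c = c) ∧ h a = u ∧
    ∃ x, Box o A L x ∧ ¬ r (h x) w with hRdef
  have hRinv : ∀ g ∈ G, (∀ c ∈ A.erase a, g c = c) → ∀ u w, R u w → R (g u) (g w) := by
    rintro g hg hgA u w ⟨h, hh, hhA, hha, x, hx, hxw⟩
    refine ⟨g * h, G.mul_mem hg hh, fun c hc => ?_, ?_, x, hx, ?_⟩
    · simp [hhA c hc, hgA c hc]
    · simp [hha]
    · simpa [ho.inv.iff hg] using hxw
  obtain ⟨x₀, hx₀⟩ := hA.exists_box hG hL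
  have hRR : ∀ u, V u → R u u := by
    intro u hu
    obtain ⟨h, hh, hhA, rfl⟩ := hVa.conj_point hG hu
    exact ⟨h, hh, hhA, rfl, x₀, hx₀, ho.asymm (ho.inv h hh _ _ (hLa _ hx₀))⟩
  have hcut : Cut G r (Transfer G V R) := by
    refine ⟨Transfer.invar, ?_⟩
    intro b c c' hbc hc
    obtain ⟨g, hg, hgV⟩ := hVfull {b, c, c'} (by simp)
    have hb := hgV b (by simp)
    obtain ⟨h, hh, hhA, hha, x, hx, hxc⟩ := Transfer.of hG hRinv hb
      (hgV c (by simp)) (Transfer.invar g hg _ _ hbc)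
    exact ⟨g, hg, hb, hgV c' (by simp), h, hh, hhA, hha, x, hx, fun H =>
      hxc (ho.trans H (ho.inv g hg _ _ hc))⟩
  by_cases hex : ∃ b c, r b c ∧ Transfer G V R b c
  · have hall := hG.tame.top ho _ hcut (fun b => by
      obtain ⟨g, hg, hgV⟩ := hVfull {b} (by simp)
      exact ⟨g, hg, hgV b rfl, hgV b rfl, hRR _ (hgV b rfl)⟩) hex
    obtain ⟨y, hy⟩ := hA.exists_box hG hM
    have habove : ∀ y₁, Box o (A.erase a) M y₁ → r a y₁ := by
      intro y₁ hy₁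
      obtain ⟨h, hh, hhA, rfl⟩ := hy₁.conj_point hG (hrestr hy)
      have hVh : V (h a) := hVa.map hG hh hhA
      obtain ⟨h', hh', hhA', hha', x, hx, hxa⟩ := Transfer.of hG hRinv hVa hVh (hall a (h a))
      have := hcon _ _ (hx.map hG hh' (hfix hhA' hha')) hy
      rw [← ho.inv.iff hh]
      exact ho.lt_of_not_of_lt hxa this
    obtain ⟨t, ht, hta, htr⟩ := hG.exists_adjacent_cut hr a
    obtain ⟨z, hz⟩ := hA.exists_box hG (L := Function.update M i t) (by
      intro j b hb c hc hbc hjc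
      by_cases e : j = i
      · subst e
        simp only [Function.update_self] at hjc ⊢
        exact ht b c hbc hjc
      · rw [Function.update_of_ne e] at hjc ⊢
        exact hM j b hb c hc hbc hjc)
    have hza : r z a := htr z (fun e => hz.1 (e ▸ ha)) (by simpa using hz.2 i a ha)
    refine ho.asymm hza (habove z ⟨fun h => hz.1 (hsub h), fun j c hc => ?_⟩)
    rw [hz.2 j c (hsub hc)]
    by_cases e : j = i
    · subst e
      rw [Function.update_self, hta c (Finset.ne_of_mem_erase hc),
        hadj c (hsub hc) (Finset.ne_of_mem_erase hc)]
    · rw [Function.update_of_ne e]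
  · push Not at hex
    obtain ⟨q, hq⟩ := hG.corner (s := fun j => if L j a then flip (o j) else o j)
      (fun j => by by_cases h : L j a <;> simp [h]) (B := {a}) (by simp)
    have hqa : ∀ j, o j a q ↔ L j a := by
      intro j
      have := hq a rfl j
      by_cases h : L j a
      · simp only [h, if_true] at this
        exact iff_of_true this h
      · simp only [h, if_false] at this
        exact iff_of_false ((hG.ord j).asymm this) h
    have hqne : q ≠ a := by
      have := hq a rfl i
      by_cases h : L i a
      · simp only [h, if_true] at this
        exact ((hG.ord i).ne this).symm
      · simp only [h, if_false] at this
        exact (hG.ord i).ne this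
    obtain ⟨g, hg, hgV⟩ := hVfull {a, q} (by simp)
    obtain ⟨h, hh, hhA, hha⟩ := Box.conj_point hG (hgV a (by simp)) hVa
    have hv : V (h (g q)) := (hgV q (by simp)).map hG hh hhA
    have hvL : ∀ j, o j a (h (g q)) ↔ L j a := by
      intro j
      have h1 := (hG.ord j).inv.iff hh (g a) (g q)
      rw [hha] at h1
      rw [h1, (hG.ord j).inv.iff hg, hqa j]
    have hvne : a ≠ h (g q) := by
      intro e
      rw [← hha] at e
      exact hqne (g.injective (h.injective e)).symm
    have hrv : r a (h (g q)) :=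
      hG.lt_of_iff hr hvne (by rw [hvL i, hx₀.2 i a ha]) (hLa x₀ hx₀)
    generalize h (g q) = v at hv hvL hvne hrv
    obtain ⟨h', hh', hhA', rfl⟩ := hVa.conj_point hG hv
    have hrx : r (h' a) (h' x₀) := ho.inv h' hh' _ _ (hLa x₀ hx₀)
    have hx₁ := (hrestr hx₀).map hG hh' hhA'
    refine hex a (h' a) hrv ⟨1, G.one_mem, hVa, hv, 1, G.one_mem, fun _ _ => rfl, rfl, h' x₀,
      ⟨fun h => ?_, fun j c hc => ?_⟩, ho.asymm hrx⟩
    · exact hx₁.1 (Finset.mem_erase.2 ⟨(ho.ne (ho.trans hrv hrx)).symm, h⟩)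
    · by_cases e : c = a
      · subst e
        have h1 := (hG.ord j).inv.iff hh' c x₀
        rw [hx₀.2 j c ha] at h1
        by_cases hLc : L j c
        · exact iff_of_true ((hG.ord j).trans ((hvL j).2 hLc) (h1.2 hLc)) hLc
        · refine iff_of_false (fun H => ?_) hLc
          have h2 := (hG.ord j).lt_of_not hvne fun h => hLc ((hvL j).1 h)
          exact hLc (h1.1 ((hG.ord j).trans h2 H))
      · exact hx₁.2 j c (Finset.mem_erase.2 ⟨e, hc⟩)

theorem Indep.exists_box_lt [Finite ι] (hG : Indep G o) (hA : ∀ B ⊆ A, Full G o B)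
    (hL : ValidCut o A L) (hM : ValidCut o A M) (hLM : ∀ c ∈ A, (L i c ↔ M i c)) :
    ∃ x y, Box o A L x ∧ Box o A M y ∧ o i y x := by
  classical
  have ho := hG.ord i
  have hAA := hA A subset_rfl
  by_contra! hcon
  by_cases hsame : ∃ z, Box o A L z ∧ Box o A M z
  · obtain ⟨z, hz, hz'⟩ := hsame
    obtain ⟨v, hv⟩ := hG.tame.exists_lt ho z
    obtain ⟨g, hg, H⟩ := hAA L hL {z, v} (by simp)
    have h1 := H v (by simp)
    refine hcon _ _ (H z (by simp)) ⟨h1.1, fun j c hc => ?_⟩ (ho.inv g hg _ _ hv)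
    rw [h1.2 j c hc, ← hz.2 j c hc, hz'.2 j c hc]
  · have hlt : ∀ x y, Box o A L x → Box o A M y → o i x y := fun x y hx hy =>
      ho.lt_of_not (fun e => hsame ⟨x, hx, e ▸ hy⟩) (hcon x y hx hy)
    by_cases hne : (A.filter (L i)).Nonempty
    · obtain ⟨a, ha, hmax⟩ := ho.exists_max hne
      rw [Finset.mem_filter] at ha
      obtain ⟨x, y, hx, hy, h⟩ := hG.exists_not_lt ha.1 hAA (hA _ (Finset.erase_subset _ _)) hL hM
        (.inl rfl) (fun x hx => (hx.2 i a ha.1).2 ha.2) fun c hc hca => by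
          rw [← hLM c hc]
          exact ⟨fun h => hmax c (Finset.mem_filter.2 ⟨hc, h⟩) hca, fun h => hL i c hc a ha.1 h ha.2⟩
      exact h (hlt x y hx hy)
    · rw [Finset.not_nonempty_iff_eq_empty, Finset.filter_eq_empty_iff] at hne
      have hAne : A.Nonempty := by
        rw [Finset.nonempty_iff_ne_empty]
        rintro rfl
        obtain ⟨z, -⟩ := hG.tame.nontriv
        exact hsame ⟨z, by simp [Box], by simp [Box]⟩
      obtain ⟨a, ha, hmin⟩ := ho.flip.exists_max hAne
      obtain ⟨y, x, hy, hx, h⟩ := hG.exists_not_lt ha hAA (hA _ (Finset.erase_subset _ _)) hM hL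
        (.inr rfl) (fun y hy => ho.lt_of_not (fun e => hy.1 (e ▸ ha)) fun h =>
          hne ha ((hLM a ha).2 ((hy.2 i a ha).1 h))) fun c hc hca =>
          iff_of_false (hne hc) (ho.asymm (hmin c hc hca))
      exact h (hlt x y hx hy)

theorem Indep.exists_box_dir [Finite ι] (hG : Indep G o) (hA : ∀ B ⊆ A, Full G o B)
    (hL : ValidCut o A L) (hM : ValidCut o A M) (hLM : ∀ c ∈ A, (L i c ↔ M i c))
    (hr : r = o i ∨ r = flip (o i)) : ∃ x y, Box o A L x ∧ Box o A M y ∧ r y x := by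
  rcases hr with rfl | rfl
  · exact hG.exists_box_lt hA hL hM hLM
  · obtain ⟨y, x, hy, hx, h⟩ := hG.exists_box_lt hA hM hL fun c hc => (hLM c hc).symm
    exact ⟨x, y, hx, hy, h⟩

theorem Indep.exists_box_dirs [Finite ι] (hG : Indep G o) (hA : ∀ B ⊆ A, Full G o B)
    (hL : ValidCut o A L) (hM : ValidCut o A M) (hs : ∀ i, s i = o i ∨ s i = flip (o i))
    {J : Set ι} (hJ : J.Finite) (hLM : ∀ i ∈ J, ∀ c ∈ A, (L i c ↔ M i c)) {b : Γ}
    (hb : Box o A M b) : ∃ x, Box o A L x ∧ ∀ j ∈ J, s j b x := by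
  have hAA := hA A subset_rfl
  induction J, hJ using Set.Finite.induction_on generalizing b with
  | empty =>
    obtain ⟨x, hx⟩ := hAA.exists_box hG hL
    exact ⟨x, hx, by simp⟩
  | @insert i J hi hJ ih =>
    have ho := fun j => hG.dir (hs j)
    replace ih : ∀ b, Box o A M b → ∃ x, Box o A L x ∧ ∀ j ∈ J, s j b x :=
      fun b hb => ih (fun j hj => hLM j (.inr hj)) hb
    set R : Γ → Γ → Prop := fun c d => ∃ x, Box o A L x ∧ (∀ j ∈ J, s j c x) ∧ s i d x with hR
    have hRinv : ∀ g ∈ G, (∀ c ∈ A, g c = c) → ∀ u w, R u w → R (g u) (g w) := by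
      rintro g hg hgA u w ⟨x, hx, h1, h2⟩
      exact ⟨g x, hx.map hG hg hgA, fun j hj => (ho j).inv g hg _ _ (h1 j hj),
        (ho i).inv g hg _ _ h2⟩
    suffices h : Transfer G (Box o A M) R b b by
      obtain ⟨x, hx, h1, h2⟩ := Transfer.of hG hRinv hb hb h
      refine ⟨x, hx, ?_⟩
      rintro j (rfl | hj)
      exacts [h2, h1 j hj]
    by_contra hn
    have hn' : ∀ c, ¬ Transfer G (Box o A M) R c c :=
      hG.tame.forall_of (fun g hg c h => by rwa [Transfer.invar.iff hg]) hn
    have hcut : Cut G (flip (s i)) fun c d => ¬ Transfer G (Box o A M) R c d := by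
      refine ⟨fun g hg c d h => by rwa [Transfer.invar.iff hg], ?_⟩
      intro c d d' h hd h'
      obtain ⟨g, hg, hgM⟩ := hAA M hM {c, d, d'} (by simp)
      have hc := hgM c (by simp)
      obtain ⟨x, hx, h1, h2⟩ := Transfer.of hG hRinv hc
        (hgM d' (by simp)) (Transfer.invar g hg _ _ h')
      exact h ⟨g, hg, hc, hgM d (by simp), x, hx, h1, (ho i).trans ((ho i).inv g hg _ _ hd) h2⟩
    by_cases hex : ∃ c d, flip (s i) c d ∧ ¬ Transfer G (Box o A M) R c d
    · have hall := hG.tame.top (ho i).flip _ hcut hn' hex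
      obtain ⟨x, d, hx, hd, hdx⟩ := hG.exists_box_dir hA hL hM (hLM i (.inl rfl)) (hs i)
      obtain ⟨x₁, hx₁, h₁⟩ := ih b hb
      obtain ⟨h, hh, hhA, rfl⟩ := hx₁.conj_point hG hx
      exact hall (h b) d ⟨1, G.one_mem, hb.map hG hh hhA, hd, h x₁, hx,
        fun j hj => (ho j).inv h hh _ _ (h₁ j hj), hdx⟩
    · push Not at hex
      obtain ⟨d, hd⟩ := hG.corner hs (B := {b}) (by simp)
      obtain ⟨g, hg, h1, h2, x, hx, h3, h4⟩ := hex b d (hd b rfl i)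
      exact hn' d ⟨g, hg, h2, h2, x, hx,
        fun j hj => (ho j).trans ((ho j).inv g hg _ _ (hd b rfl j)) (h3 j hj), h4⟩

theorem Indep.full_insert [Finite ι] [Nonempty ι] [DecidableEq Γ] (hG : Indep G o)
    (hA : ∀ B ⊆ A, Full G o B) {b : Γ} (hb : b ∉ A) : Full G o (insert b A) := by
  classical
  intro L hL F hF
  have hAA := hA A subset_rfl
  have hL' : ValidCut o A L := fun i c hc d hd =>
    hL i c (Finset.mem_insert_of_mem hc) d (Finset.mem_insert_of_mem hd)
  have hM : ValidCut o A fun j c => o j c b := fun j c _ d _ hcd hd => (hG.ord j).trans hcd hd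
  have hbM : Box o A (fun j c => o j c b) b := ⟨hb, fun _ _ _ => Iff.rfl⟩
  set s : ι → Γ → Γ → Prop := fun j => if L j b then o j else flip (o j) with hsdef
  have hs : ∀ j, s j = o j ∨ s j = flip (o j) := fun j => by
    by_cases h : L j b <;> simp [hsdef, h]
  have ho := fun j => hG.dir (hs j)
  obtain ⟨x, hx, hbx⟩ := hG.exists_box_dirs hA hL' hM hs (Set.toFinite
    {j | ∀ c ∈ A, (L j c ↔ o j c b)}) (fun j hj => hj) hbM
  have hauto : ∀ j, (¬ ∀ c ∈ A, (L j c ↔ o j c b)) → ∀ z, Box o A L z → s j b z := by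
    intro j hj z hz
    push Not at hj
    obtain ⟨c, hc, h⟩ := hj
    have hcb : c ≠ b := fun e => hb (e ▸ hc)
    have hcz : c ≠ z := fun e => hz.1 (e ▸ hc)
    rcases h with ⟨h1, h2⟩ | ⟨h1, h2⟩
    · have h3 := (hG.ord j).lt_of_not hcb h2
      have h4 := hL j b (by simp) c (by simp [hc]) h3 h1
      simpa [hsdef, h4] using (hG.ord j).trans h3 ((hz.2 j c hc).2 h1)
    · have h4 : ¬ L j b := fun h => h1 (hL j c (by simp [hc]) b (by simp) h2 h)
      have h5 := (hG.ord j).lt_of_not hcz fun h => h1 ((hz.2 j c hc).1 h)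
      simpa [hsdef, h4, flip] using (hG.ord j).trans h5 h2
  obtain ⟨p, hp⟩ := hG.corner hs hF
  obtain ⟨g, hg, hgL⟩ := hAA L hL' (insert p F) (hF.insert p)
  obtain ⟨h, hh, hhA, hhx⟩ := (hgL p (by simp)).conj_point hG hx
  refine ⟨h * g, G.mul_mem hh hg, fun f hf => ?_⟩
  have hz : Box o A L (h (g f)) := (hgL f (by simp [hf])).map hG hh hhA
  have hbz : ∀ j, s j b (h (g f)) := by
    intro j
    by_cases hj : ∀ c ∈ A, (L j c ↔ o j c b)
    · have := (ho j).inv h hh _ _ ((ho j).inv g hg _ _ (hp f hf j))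
      rw [hhx] at this
      exact (ho j).trans (hbx j hj) this
    · exact hauto j hj _ hz
  rw [Equiv.Perm.mul_apply]
  refine ⟨?_, fun j c hc => ?_⟩
  · rw [Finset.mem_insert, not_or]
    obtain ⟨j⟩ := ‹Nonempty ι›
    exact ⟨((ho j).ne (hbz j)).symm, hz.1⟩
  · rcases Finset.mem_insert.1 hc with rfl | hc
    · have := hbz j
      by_cases h : L j c
      · exact iff_of_true (by simpa [hsdef, h] using this) h
      · exact iff_of_false ((hG.ord j).asymm (by simpa [hsdef, h, flip] using this)) h
    · exact hz.2 j c hc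

theorem Indep.full [Finite ι] [Nonempty ι] (hG : Indep G o) (A : Finset Γ) : Full G o A := by
  classical
  have key : ∀ n, ∀ A : Finset Γ, A.card ≤ n → Full G o A := by
    intro n
    induction n with
    | zero =>
      intro A hA L _ F _
      rw [Nat.le_zero, Finset.card_eq_zero] at hA
      subst hA
      exact ⟨1, G.one_mem, fun x _ => by simp [Box]⟩
    | succ n ih =>
      intro A hA
      rcases A.eq_empty_or_nonempty with rfl | ⟨b, hb⟩
      · exact ih ∅ (by simp)
      · have := Finset.card_erase_of_mem hb
        rw [← Finset.insert_erase hb]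
        refine hG.full_insert (fun B hB => ih B ?_) (by simp)
        have := Finset.card_le_card hB
        omega
  exact key _ A le_rfl

end boxes

end OrderedAction

namespace PermStruct

open OrderedAction

variable {n : ℕ} {Γ : Type*} (S : PermStruct n Γ)

/-- The strict order underlying the `i`-th order. -/
def lt (i : Fin n) (x y : Γ) : Prop := ¬ S.le i y x

/-- The automorphism group. -/
def autGroup : Subgroup (Equiv.Perm Γ) where
  carrier := {σ | S.IsAuto σ}
  mul_mem' {σ τ} hσ hτ i x y := (hτ i x y).trans (hσ i (τ x) (τ y))
  one_mem' _ _ _ := Iff.rfl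
  inv_mem' {σ} hσ i x y := by simpa using (hσ i (σ⁻¹ x) (σ⁻¹ y)).symm

variable {S}

theorem invOrder_lt (i : Fin n) : InvOrder S.autGroup (S.lt i) where
  inv g hg x y h := fun h' => h ((hg i y x).2 h')
  irrefl x h := h ((S.total i x x).elim id id)
  trans {x y z} h h' hzx := by
    have hxy := (S.total i x y).resolve_right h
    exact h' (S.trans i z x y hzx hxy)
  total {x y} hne := by
    by_contra! hcon
    exact hne (S.antisymm i x y (not_not.1 hcon.2) (not_not.1 hcon.1))

theorem le_iff_lt {i : Fin n} {x y : Γ} (hne : x ≠ y) : S.le i x y ↔ S.lt i x y :=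
  ⟨fun h h' => hne (S.antisymm i x y h h'), fun h => (S.total i x y).resolve_right h⟩

theorem Homogeneous.exists_auto [NeZero n] (hS : S.Homogeneous) {κ : Type*} [Finite κ]
    (x y : κ → Γ) (h : ∀ i a b, S.lt i (x a) (x b) ↔ S.lt i (y a) (y b)) :
    ∃ g ∈ S.autGroup, ∀ a, g (x a) = y a := by
  classical
  have heq : ∀ a b, x a = x b ↔ y a = y b := by
    have key : ∀ x y : κ → Γ, (∀ a b, S.lt 0 (x a) (x b) ↔ S.lt 0 (y a) (y b)) →
        ∀ a b, x a = x b → y a = y b := by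
      intro x y h a b hab
      by_contra hne
      rcases (invOrder_lt (S := S) 0).total hne with H | H
      · exact (invOrder_lt (S := S) 0).irrefl _ (hab ▸ (h a b).2 H)
      · exact (invOrder_lt (S := S) 0).irrefl _ (hab ▸ (h b a).2 H)
    exact fun a b => ⟨key x y (h 0) a b, key y x (fun a b => (h 0 a b).symm) a b⟩
  set f : Γ → Γ := fun z => if h : ∃ a, x a = z then y h.choose else z with hf
  have hfx : ∀ a, f (x a) = y a := by
    intro a
    have hex : ∃ b, x b = x a := ⟨a, rfl⟩
    simp only [hf, dif_pos hex]
    exact (heq _ _).1 hex.choose_spec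
  have hinj : Set.InjOn f (Set.finite_range x).toFinset := by
    rintro u hu v hv huv
    simp only [Set.Finite.coe_toFinset] at hu hv
    obtain ⟨a, rfl⟩ := hu
    obtain ⟨b, rfl⟩ := hv
    rw [hfx, hfx] at huv
    exact (heq a b).2 huv
  have hle : ∀ i, ∀ u ∈ (Set.finite_range x).toFinset, ∀ v ∈ (Set.finite_range x).toFinset,
      (S.le i u v ↔ S.le i (f u) (f v)) := by
    intro i u hu v hv
    rw [Set.Finite.mem_toFinset] at hu hv
    obtain ⟨a, rfl⟩ := hu
    obtain ⟨b, rfl⟩ := hv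
    rw [hfx, hfx]
    exact not_iff_not.1 (h i b a)
  obtain ⟨σ, hσ, H⟩ := hS _ f hinj hle
  exact ⟨σ, hσ, fun a => by rw [H (x a) (by simp), hfx]⟩

theorem Homogeneous.finite_invar [NeZero n] (hS : S.Homogeneous) :
    {R | Invar S.autGroup R}.Finite := by
  refine Set.Finite.of_injOn (t := Set.univ)
    (f := fun (R : Γ → Γ → Prop) (t : Fin n → Prop × Prop) =>
      ∃ x y, (∀ i, t i = (S.lt i x y, S.lt i y x)) ∧ R x y)
    (fun _ _ => Set.mem_univ _) ?_ Set.finite_univ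
  have key : ∀ R R' : Γ → Γ → Prop, Invar S.autGroup R' →
      (fun t : Fin n → Prop × Prop => ∃ x y, (∀ i, t i = (S.lt i x y, S.lt i y x)) ∧ R x y) =
      (fun t => ∃ x y, (∀ i, t i = (S.lt i x y, S.lt i y x)) ∧ R' x y) →
      ∀ x y, R x y → R' x y := by
    intro R R' hR' h x y hxy
    have h1 := congrFun h fun i => (S.lt i x y, S.lt i y x)
    obtain ⟨x', y', ht, hxy'⟩ := h1.mp ⟨x, y, fun _ => rfl, hxy⟩
    obtain ⟨g, hg, H⟩ := hS.exists_auto ![x', y'] ![x, y] (by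
      have hirr := fun i => (invOrder_lt (S := S) i).irrefl
      intro i
      have h2 := ht i
      simp only [Prod.mk.injEq] at h2
      simp [Fin.forall_fin_succ, hirr, h2])
    have h3 := hR' g hg _ _ hxy'
    have e1 : g x' = x := H 0
    have e2 : g y' = y := H 1
    rwa [e1, e2] at h3
  intro R hR R' hR' h
  funext x y
  exact propext ⟨key R R' hR' h x y, key R' R hR h.symm x y⟩

theorem Homogeneous.tame [NeZero n] [Nontrivial Γ] (hS : S.Homogeneous)
    (hprim : ∀ E : Γ → Γ → Prop, S.Definable E → Equivalence E →
      (∀ x y, E x y ↔ x = y) ∨ (∀ x y, E x y)) : Tame S.autGroup where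
  hom x y h := hS.exists_auto x y fun i => h _ (invOrder_lt i)
  prim E hE hE' := (hprim E (fun σ hσ x y => (hE.iff (g := σ) hσ x y).symm) hE').imp_left
    fun h x y => (h x y).1
  fin := hS.finite_invar
  nontriv := inferInstance

theorem Homogeneous.indep [NeZero n] [Nontrivial Γ] (hS : S.Homogeneous)
    (hprim : ∀ E : Γ → Γ → Prop, S.Definable E → Equivalence E →
      (∀ x y, E x y ↔ x = y) ∨ (∀ x y, E x y))
    (hne : ∀ i j, i ≠ j → ¬ (∀ x y, S.le i x y ↔ S.le j x y))
    (hnrev : ∀ i j, i ≠ j → ¬ (∀ x y, S.le i x y ↔ S.le j y x)) : Indep S.autGroup S.lt where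
  tame := hS.tame hprim
  ord := invOrder_lt
  perp i j hij := (hS.tame hprim).perp_of_ne (invOrder_lt i) (invOrder_lt j)
    (fun h => hne i j hij fun x y => not_iff_not.1 (congrFun (congrFun h y) x).to_iff)
    (fun h => hnrev i j hij fun x y => not_iff_not.1 (congrFun (congrFun h y) x).to_iff)
  hom x y h := hS.exists_auto x y h

end PermStruct

/-- A primitive homogeneous `n`-dimensional permutation structure, with no two orders equal and
no order the reverse of another, is the Fraïssé limit of the class of all finite sets with `n`
linear orders: the one-point extension property holds. -/
theorem primitive_homogeneous_is_generic
    {n : ℕ} {Γ : Type*} [Countable Γ] [Infinite Γ] (S : PermStruct n Γ)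
    (hhom : S.Homogeneous)
    (hprim : ∀ E : Γ → Γ → Prop, S.Definable E → Equivalence E →
      (∀ x y, E x y ↔ x = y) ∨ (∀ x y, E x y))
    (hne : ∀ i j, i ≠ j → ¬ (∀ x y, S.le i x y ↔ S.le j x y))
    (hnrev : ∀ i j, i ≠ j → ¬ (∀ x y, S.le i x y ↔ S.le j y x))
    (A : Finset Γ) (L : Fin n → Finset Γ) (hL : ∀ i, L i ⊆ A)
    (hinit : ∀ i, ∀ a ∈ A, ∀ b ∈ L i, S.le i a b → a ∈ L i) :
    ∃ x, x ∉ A ∧ ∀ i, ∀ a ∈ A, (S.le i a x ↔ a ∈ L i) := by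
  rcases Nat.eq_zero_or_pos n with rfl | hn
  · obtain ⟨x, hx⟩ := Infinite.exists_notMem_finset A
    exact ⟨x, hx, fun i => i.elim0⟩
  · have : NeZero n := ⟨hn.ne'⟩
    have hG := hhom.indep hprim hne hnrev
    obtain ⟨x, hx, h⟩ := (hG.full A).exists_box hG (L := fun i c => c ∈ L i)
      fun i a ha b _ hab hb => hinit i a ha b hb ((S.total i a b).resolve_right hab)
    exact ⟨x, hx, fun i a ha =>
      (PermStruct.le_iff_lt (ne_of_mem_of_not_mem ha hx)).trans (h i a ha)⟩
end

section
/- Let M be a countably infinite homogeneous structure in a finite binary relational language with a distinguished linear order ≤ among its relations. Let E be the coarsest proper ∅-definable ≤-convex equivalence relation on M, i.e., E is ∅-definable, ≤-convex, not the trivial relation, and every ∅-definable ≤-convex equivalence relation other than the trivial relation refines E. Then M/E has topological rank 1: there do not exist a finite set A ⊆ M and an equivalence relation F on M such that F is invariant under all automorphisms of M fixing A pointwise, E refines F, F is ≤-convex, and F has infinitely many classes each of which contains infinitely many E-classes. -/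
/-- A structure on `M` with `m` binary relations, among which a distinguished linear order,
given by the index `ord`. -/
structure BinStruct (m : ℕ) (M : Type*) where
  rel : Fin m → M → M → Prop
  ord : Fin m
  total : ∀ x y, rel ord x y ∨ rel ord y x
  antisymm : ∀ x y, rel ord x y → rel ord y x → x = y
  trans : ∀ x y z, rel ord x y → rel ord y z → rel ord x z

namespace BinStruct

variable {m : ℕ} {M : Type*} (S : BinStruct m M)

/-- The distinguished linear order. -/
def le (x y : M) : Prop := S.rel S.ord x y

/-- An automorphism: a bijection of `M` preserving all the relations. -/
def IsAuto (σ : M ≃ M) : Prop :=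
  ∀ i x y, S.rel i x y ↔ S.rel i (σ x) (σ y)

/-- Homogeneity: every isomorphism between finite substructures extends to an automorphism. -/
def Homogeneous : Prop :=
  ∀ (A : Finset M) (f : M → M), Set.InjOn f A →
    (∀ i, ∀ x ∈ A, ∀ y ∈ A, (S.rel i x y ↔ S.rel i (f x) (f y))) →
    ∃ σ : M ≃ M, S.IsAuto σ ∧ ∀ a ∈ A, σ a = f a

/-- A binary relation is ∅-definable iff it is invariant under all automorphisms. -/
def Definable (R : M → M → Prop) : Prop :=
  ∀ σ : M ≃ M, S.IsAuto σ → ∀ x y, R x y ↔ R (σ x) (σ y)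

/-- `E` is `≤`-convex: every `E`-class is an interval with respect to `≤`. -/
def Convex (E : M → M → Prop) : Prop :=
  ∀ x y z, S.le x y → S.le y z → E x z → E x y

/-- The automorphism group acts transitively on `M`. -/
def TransAction : Prop := ∀ x y : M, ∃ σ : M ≃ M, S.IsAuto σ ∧ σ x = y

/-- The pairs `(a,b)` and `(c,d)` lie in the same orbit of the automorphism group. -/
def SamePairOrbit (a b c d : M) : Prop := ∃ σ : M ≃ M, S.IsAuto σ ∧ σ a = c ∧ σ b = d

/-- `M` is order-like: whenever `(a,b)` and `(b,c)` lie in the same orbit of the automorphism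
group acting on `M × M`, the pair `(a,c)` also lies in that orbit. -/
def OrderLike : Prop := ∀ a b c : M, S.SamePairOrbit a b b c → S.SamePairOrbit a b a c

/-- A cut of `(M, ≤)`: a nonempty, proper, downward closed subset with no greatest element. -/
def IsCut (C : Set M) : Prop :=
  C.Nonempty ∧ C ≠ Set.univ ∧ (∀ x y, S.le x y → y ∈ C → x ∈ C) ∧
    (∀ x ∈ C, ∃ y ∈ C, S.le x y ∧ x ≠ y)

end BinStruct

namespace BinStruct

universe u

variable {m : ℕ} {M : Type u} {S : BinStruct m M}

theorem le_refl (S : BinStruct m M) (x : M) : S.le x x := (S.total x x).elim id id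

theorem le_of_not_le {x y : M} (h : ¬ S.le x y) : S.le y x := (S.total x y).resolve_left h

theorem IsAuto.refl : S.IsAuto (Equiv.refl M) := fun _ _ _ => Iff.rfl

theorem IsAuto.symm {σ : M ≃ M} (h : S.IsAuto σ) : S.IsAuto σ.symm := fun i x y => by
  simpa using (h i (σ.symm x) (σ.symm y)).symm

theorem IsAuto.trans {σ τ : M ≃ M} (h : S.IsAuto σ) (h' : S.IsAuto τ) :
    S.IsAuto (σ.trans τ) := fun i x y => (h i x y).trans (h' i _ _)

theorem IsAuto.le_iff {σ : M ≃ M} (h : S.IsAuto σ) (x y : M) :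
    S.le x y ↔ S.le (σ x) (σ y) := h _ x y

/-- The atomic type of the pair `(x, y)`. -/
def pairType (S : BinStruct m M) (x y : M) : Fin m → Prop × Prop × Prop × Prop :=
  fun i => (S.rel i x x, S.rel i x y, S.rel i y x, S.rel i y y)

/-- The atomic relations between `x` and the elements of `A`. -/
def profile (S : BinStruct m M) (A : Finset M) (x : M) : Fin m → A → Prop × Prop :=
  fun i a => (S.rel i a x, S.rel i x a)

theorem IsAuto.pairType_eq {σ : M ≃ M} (h : S.IsAuto σ) (x y : M) :
    S.pairType (σ x) (σ y) = S.pairType x y := by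
  funext i
  simp [pairType, ← h i]

theorem pairType_eq_iff {x y x' y' : M} (h : S.pairType x y = S.pairType x' y') (i : Fin m) :
    (S.rel i x x ↔ S.rel i x' x') ∧ (S.rel i x y ↔ S.rel i x' y') ∧
      (S.rel i y x ↔ S.rel i y' x') ∧ (S.rel i y y ↔ S.rel i y' y') := by
  simpa [pairType] using congrFun h i

theorem profile_eq_iff {A : Finset M} {x y : M} (h : S.profile A x = S.profile A y) (i : Fin m)
    {a : M} (ha : a ∈ A) : (S.rel i a x ↔ S.rel i a y) ∧ (S.rel i x a ↔ S.rel i y a) := by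
  simpa [profile] using congrFun (congrFun h i) ⟨a, ha⟩

theorem eq_of_profile_eq {A : Finset M} {x y : M} (h : S.profile A x = S.profile A y)
    (hx : x ∈ A) : y = x := by
  obtain ⟨h₁, h₂⟩ := profile_eq_iff h S.ord hx
  exact S.antisymm _ _ (h₂.1 (S.le_refl x)) (h₁.1 (S.le_refl x))

/-- In a homogeneous binary structure, the type of a pair over `A` is determined by its atomic
type and the profiles of its two entries. -/
theorem Homogeneous.exists_isAuto (hhom : S.Homogeneous) {A : Finset M} {x y x' y' : M}
    (hx : S.profile A x = S.profile A x') (hy : S.profile A y = S.profile A y')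
    (hxy : S.pairType x y = S.pairType x' y') :
    ∃ σ : M ≃ M, S.IsAuto σ ∧ (∀ a ∈ A, σ a = a) ∧ σ x = x' ∧ σ y = y' := by
  classical
  have hdiag : x = y → x' = y' := by
    rintro rfl
    obtain ⟨-, h₁, h₂, -⟩ := pairType_eq_iff hxy S.ord
    exact S.antisymm _ _ (h₁.1 (S.le_refl x)) (h₂.1 (S.le_refl x))
  let f : M → M := fun z => if z = x then x' else if z = y then y' else z
  have fx : f x = x' := by simp [f]
  have fy : f y = y' := by
    by_cases h : y = x
    · simpa [f, h] using hdiag h.symm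
    · simp [f, h]
  have fA : ∀ a ∈ A, f a = a := by
    intro a ha
    by_cases h : a = x
    · subst h
      rw [fx, eq_of_profile_eq hx ha]
    by_cases h' : a = y
    · subst h'
      rw [fy, eq_of_profile_eq hy ha]
    simp [f, h, h']
  have hrel : ∀ i, ∀ u ∈ insert x (insert y A), ∀ v ∈ insert x (insert y A),
      (S.rel i u v ↔ S.rel i (f u) (f v)) := by
    intro i u hu v hv
    obtain ⟨h₁, h₂, h₃, h₄⟩ := pairType_eq_iff hxy i
    rw [Finset.mem_insert, Finset.mem_insert] at hu hv
    rcases hu with rfl | rfl | hu <;> rcases hv with rfl | rfl | hv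
    · rwa [fx]
    · rwa [fx, fy]
    · rw [fx, fA v hv]; exact (profile_eq_iff hx i hv).2
    · rwa [fx, fy]
    · rwa [fy]
    · rw [fy, fA v hv]; exact (profile_eq_iff hy i hv).2
    · rw [fx, fA u hu]; exact (profile_eq_iff hx i hu).1
    · rw [fy, fA u hu]; exact (profile_eq_iff hy i hu).1
    · rw [fA u hu, fA v hv]
  have hinj : Set.InjOn f (insert x (insert y A) : Finset M) := by
    intro u hu v hv huv
    refine S.antisymm u v ((hrel _ u hu v hv).2 ?_) ((hrel _ v hv u hu).2 ?_) <;>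
      rw [huv] <;> exact S.le_refl _
  obtain ⟨σ, hσ, hf⟩ := hhom _ f hinj hrel
  refine ⟨σ, hσ, fun a ha => ?_, ?_, ?_⟩
  · rw [hf a (by simp [ha]), fA a ha]
  · rw [hf x (by simp), fx]
  · rw [hf y (by simp), fy]

/-- An increasing family of definable relations covering all pairs is eventually everything. -/
theorem Homogeneous.exists_forall_of_monotone (hhom : S.Homogeneous) {R : ℕ → M → M → Prop}
    (hdef : ∀ n, S.Definable (R n)) (hmono : ∀ n x y, R n x y → R (n + 1) x y)
    (hall : ∀ x y, ∃ n, R n x y) : ∃ n, ∀ x y, R n x y := by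
  have hle : ∀ {k n}, k ≤ n → ∀ x y, R k x y → R n x y := by
    intro k n hkn x y h
    induction hkn with
    | refl => exact h
    | step _ ih => exact hmono _ _ _ ih
  have htype : ∀ t, ∃ n, ∀ x y, S.pairType x y = t → R n x y := by
    intro t
    by_cases ht : ∃ x y, S.pairType x y = t
    · obtain ⟨x, y, rfl⟩ := ht
      obtain ⟨n, hn⟩ := hall x y
      refine ⟨n, fun x' y' h => ?_⟩
      obtain ⟨σ, hσ, -, rfl, rfl⟩ := hhom.exists_isAuto (A := ∅) (x := x) (y := y)
        (x' := x') (y' := y') (by funext i a; exact absurd a.2 (Finset.notMem_empty _))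
        (by funext i a; exact absurd a.2 (Finset.notMem_empty _)) h.symm
      exact (hdef n σ hσ x y).1 hn
    · exact ⟨0, fun x y h => absurd ⟨x, y, h⟩ ht⟩
  choose N hN using htype
  obtain ⟨n, hn⟩ := (Set.finite_range N).bddAbove
  exact ⟨n, fun x y => hle (hn ⟨_, rfl⟩) x y (hN _ x y rfl)⟩

/-- `w` lies at or below `z`, or below the right endpoint of some conjugate of the interval
`[x, y]` whose left endpoint lies at or below `z`. -/
def Covers (S : BinStruct m M) (x y z w : M) : Prop :=
  S.le w z ∨ ∃ σ : M ≃ M, S.IsAuto σ ∧ S.le (σ x) z ∧ S.le w (σ y)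

theorem Covers.mono {x y z w z' w' : M} (h : S.Covers x y z w) (hz : S.le z z')
    (hw : S.le w' w) : S.Covers x y z' w' := by
  rcases h with h | ⟨σ, hσ, h₁, h₂⟩
  · exact Or.inl (S.trans _ _ _ hw (S.trans _ _ _ h hz))
  · exact Or.inr ⟨σ, hσ, S.trans _ _ _ h₁ hz, S.trans _ _ _ hw h₂⟩

theorem definable_covers (x y : M) : S.Definable (S.Covers x y) := by
  have key : ∀ τ : M ≃ M, S.IsAuto τ → ∀ z w, S.Covers x y z w →
      S.Covers x y (τ z) (τ w) := by
    rintro τ hτ z w (h | ⟨σ, hσ, h₁, h₂⟩)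
    · exact Or.inl ((hτ.le_iff _ _).1 h)
    · exact Or.inr ⟨σ.trans τ, hσ.trans hτ, (hτ.le_iff _ _).1 h₁, (hτ.le_iff _ _).1 h₂⟩
  exact fun τ hτ z w => ⟨key τ hτ z w, fun h => by simpa using key _ hτ.symm _ _ h⟩

/-- The iterates of `Covers`. -/
def IterCovers (S : BinStruct m M) (x y : M) : ℕ → M → M → Prop
  | 0, z, w => S.Covers x y z w
  | n + 1, z, w => ∃ t, S.IterCovers x y n z t ∧ S.Covers x y t w

theorem definable_iterCovers (x y : M) (n : ℕ) : S.Definable (S.IterCovers x y n) := by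
  induction n with
  | zero => exact definable_covers x y
  | succ n ih =>
    intro τ hτ z w
    constructor
    · rintro ⟨t, h₁, h₂⟩
      exact ⟨τ t, (ih τ hτ _ _).1 h₁, (definable_covers x y τ hτ _ _).1 h₂⟩
    · rintro ⟨t, h₁, h₂⟩
      exact ⟨τ.symm t, (ih τ hτ _ _).2 (by simpa using h₁),
        (definable_covers x y τ hτ _ _).2 (by simpa using h₂)⟩

theorem IterCovers.succ {x y z w : M} {n : ℕ} (h : S.IterCovers x y n z w) :
    S.IterCovers x y (n + 1) z w := ⟨w, h, Or.inl (S.le_refl w)⟩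

theorem IterCovers.of_le {x y z w w' : M} {n : ℕ} (h : S.IterCovers x y n z w)
    (hw : S.le w' w) : S.IterCovers x y n z w' := by
  cases n with
  | zero => exact h.mono (S.le_refl _) hw
  | succ n => exact h.imp fun t ht => ⟨ht.1, ht.2.mono (S.le_refl _) hw⟩

theorem IterCovers.trans {x y z w u : M} {n k : ℕ} (h : S.IterCovers x y n z w)
    (h' : S.IterCovers x y k w u) : S.IterCovers x y (n + k + 1) z u := by
  induction k generalizing u with
  | zero => exact ⟨w, h, h'⟩
  | succ k ih =>
    obtain ⟨t, h₁, h₂⟩ := h'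
    exact ⟨t, ih h₁, h₂⟩

section Coarsest

variable {E : M → M → Prop}

theorem exists_iterCovers
    (hE : ∀ F : M → M → Prop, S.Definable F → Equivalence F → S.Convex F →
      (¬ ∀ x y, F x y) → ∀ x y, F x y → E x y)
    {x y : M} (hxy : S.le x y) (hne : ¬ E x y) (z w : M) : ∃ n, S.IterCovers x y n z w := by
  let G : M → M → Prop := fun z w =>
    (∃ n, S.IterCovers x y n z w) ∧ ∃ n, S.IterCovers x y n w z
  have of_le : ∀ {z w}, S.le w z → ∃ n, S.IterCovers x y n z w := fun h => ⟨0, Or.inl h⟩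
  have hdef : S.Definable G := fun τ hτ z w =>
    and_congr (exists_congr fun n => definable_iterCovers x y n τ hτ z w)
      (exists_congr fun n => definable_iterCovers x y n τ hτ w z)
  have hequiv : Equivalence G := by
    refine ⟨fun z => ⟨of_le (S.le_refl z), of_le (S.le_refl z)⟩, fun h => ⟨h.2, h.1⟩, ?_⟩
    rintro a b c ⟨⟨n₁, h₁⟩, ⟨n₂, h₂⟩⟩ ⟨⟨n₃, h₃⟩, ⟨n₄, h₄⟩⟩
    exact ⟨⟨_, h₁.trans h₃⟩, ⟨_, h₄.trans h₂⟩⟩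
  have hconv : S.Convex G := by
    rintro a b c hab hbc ⟨⟨n, hn⟩, -⟩
    exact ⟨⟨n, hn.of_le hbc⟩, of_le hab⟩
  have hG : G x y :=
    ⟨⟨0, Or.inr ⟨Equiv.refl M, IsAuto.refl, S.le_refl x, S.le_refl y⟩⟩, of_le hxy⟩
  by_contra h
  exact hne (hE G hdef hequiv hconv (fun hall => h (hall z w).1) x y hG)

/-- If `E` is coarsest and has at least three classes, every interval not contained in one
`E`-class has a conjugate with left endpoint below `z` and right endpoint above `w`. -/
theorem covers_of_coarsest (hhom : S.Homogeneous)
    (hE : ∀ F : M → M → Prop, S.Definable F → Equivalence F → S.Convex F →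
      (¬ ∀ x y, F x y) → ∀ x y, F x y → E x y)
    {a b c : M} (hab : ¬ E a b) (hbc : ¬ E b c) (hac : ¬ E a c)
    {x y : M} (hxy : S.le x y) (hne : ¬ E x y) (z w : M) : S.Covers x y z w := by
  let U : M → Prop := fun z => ∀ w, S.Covers x y z w
  have hU_up : ∀ {z z'}, S.le z z' → U z → U z' := fun h hz w => (hz w).mono h (S.le_refl w)
  have hU_inv : ∀ τ : M ≃ M, S.IsAuto τ → ∀ z, U z ↔ U (τ z) := by
    intro τ hτ z
    refine ⟨fun h w => ?_, fun h w => (definable_covers x y τ hτ z w).2 (h (τ w))⟩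
    simpa using (definable_covers x y τ hτ z (τ.symm w)).1 (h _)
  have hU_ne : ∃ z, U z := by
    by_contra! hno
    obtain ⟨n, hn⟩ := hhom.exists_forall_of_monotone (definable_iterCovers (S := S) x y)
      (fun n _ _ h => h.succ) (exists_iterCovers hE hxy hne)
    have hbdd : ∀ k z, ∃ w, ¬ S.IterCovers x y k z w := by
      intro k z
      induction k with
      | zero =>
        by_contra! h
        exact hno z h
      | succ k ih =>
        obtain ⟨v, hv⟩ := ih
        obtain ⟨u, hu⟩ : ∃ u, ¬ S.Covers x y v u := by
          by_contra! h
          exact hno v h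
        refine ⟨u, ?_⟩
        rintro ⟨t, h₁, h₂⟩
        exact hu (h₂.mono (le_of_not_le fun h => hv (h₁.of_le h)) (S.le_refl u))
    obtain ⟨u, hu⟩ := hbdd n z
    exact hu (hn z u)
  by_contra hzw
  have hz : ¬ U z := fun h => hzw (h w)
  obtain ⟨z', hz'⟩ := hU_ne
  have hUE : ∀ p q, (U p ↔ U q) → E p q := by
    refine hE (fun p q => U p ↔ U q) (fun τ hτ p q =>
      iff_congr (hU_inv τ hτ p) (hU_inv τ hτ q)) ⟨fun _ => Iff.rfl, Iff.symm, Iff.trans⟩ ?_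
      (fun h => hz ((h z z').2 hz'))
    intro p q r hpq hqr hpr
    exact ⟨hU_up hpq, fun h => hpr.2 (hU_up hqr h)⟩
  have two_values : ∀ P Q R : Prop, (P ↔ Q) ∨ (Q ↔ R) ∨ (P ↔ R) := by
    intro P Q R
    by_cases P <;> by_cases Q <;> by_cases R <;> simp [*]
  rcases two_values (U a) (U b) (U c) with h | h | h
  · exact hab (hUE _ _ h)
  · exact hbc (hUE _ _ h)
  · exact hac (hUE _ _ h)

/-- Every finite set has a conjugate inside any interval not contained in one `E`-class. -/
theorem exists_isAuto_subset_interval (hhom : S.Homogeneous) (hequivE : Equivalence E)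
    (hE : ∀ F : M → M → Prop, S.Definable F → Equivalence F → S.Convex F →
      (¬ ∀ x y, F x y) → ∀ x y, F x y → E x y)
    {a b c : M} (hab : ¬ E a b) (hbc : ¬ E b c) (hac : ¬ E a c)
    {x y : M} (hxy : S.le x y) (hne : ¬ E x y) {X : Set M} (hX : X.Finite) :
    ∃ σ : M ≃ M, S.IsAuto σ ∧ ∀ e ∈ X, S.le x (σ e) ∧ S.le (σ e) y := by
  obtain ⟨u, v, hux, hyv, huv⟩ : ∃ u v, S.le u x ∧ S.le y v ∧
      ∀ e ∈ X, S.le u e ∧ S.le e v := by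
    induction X, hX using Set.Finite.induction_on with
    | empty => exact ⟨x, y, S.le_refl x, S.le_refl y, by simp⟩
    | @insert e X _ _ ih =>
      obtain ⟨u, v, hu, hv, h⟩ := ih
      obtain ⟨u', h₁, h₂⟩ : ∃ u', S.le u' u ∧ S.le u' e := by
        rcases S.total u e with h | h
        · exact ⟨u, S.le_refl u, h⟩
        · exact ⟨e, h, S.le_refl e⟩
      obtain ⟨v', h₃, h₄⟩ : ∃ v', S.le v v' ∧ S.le e v' := by
        rcases S.total v e with h | h
        · exact ⟨e, h, S.le_refl e⟩
        · exact ⟨v, S.le_refl v, h⟩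
      refine ⟨u', v', S.trans _ _ _ h₁ hu, S.trans _ _ _ hv h₃, ?_⟩
      rintro d (rfl | hd)
      · exact ⟨h₂, h₄⟩
      · exact ⟨S.trans _ _ _ h₁ (h d hd).1, S.trans _ _ _ (h d hd).2 h₃⟩
  rcases covers_of_coarsest hhom hE hab hbc hac hxy hne u v with h | ⟨σ, hσ, h₁, h₂⟩
  · refine absurd ?_ hne
    have hyx : S.le y x := S.trans _ _ _ hyv (S.trans _ _ _ h hux)
    rw [S.antisymm x y hxy hyx]
    exact hequivE.refl y
  · refine ⟨σ.symm, hσ.symm, fun e he => ⟨?_, ?_⟩⟩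
    · simpa using (hσ.symm.le_iff _ _).1 (S.trans _ _ _ h₁ (huv e he).1)
    · simpa using (hσ.symm.le_iff _ _).1 (S.trans _ _ _ (huv e he).2 h₂)

end Coarsest

/-- `X` contains the leaves of a binary tree of conjugates of `(A, F)`, such that the two subtrees
below a node lie in different classes of its equivalence relation, and all the leaves below a node
at depth `n` have as profile over its parameters the `n`-th entry of the list. -/
def HasTree (S : BinStruct m M) (A : Finset M) (F : M → M → Prop) :
    List (Fin m → A → Prop × Prop) → Set M → Prop
  | [], X => X.Nonempty
  | i :: v, X => ∃ τ : M ≃ M, S.IsAuto τ ∧ ∃ Y Z : Set M, Y ⊆ X ∧ Z ⊆ X ∧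
      S.HasTree A F v Y ∧ S.HasTree A F v Z ∧
      (∀ y ∈ Y, S.profile A (τ y) = i) ∧ (∀ z ∈ Z, S.profile A (τ z) = i) ∧
      (∀ y ∈ Y, ∀ y' ∈ Y, F (τ y) (τ y')) ∧ (∀ y ∈ Y, ∀ z ∈ Z, ¬ F (τ y) (τ z))

section Tree

variable {A : Finset M} {F : M → M → Prop}

theorem HasTree.mono {v : List (Fin m → A → Prop × Prop)} {X X' : Set M}
    (h : S.HasTree A F v X) (hX : X ⊆ X') : S.HasTree A F v X' := by
  cases v with
  | nil => exact Set.Nonempty.mono hX h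
  | cons i v =>
    obtain ⟨τ, hτ, Y, Z, hY, hZ, h⟩ := h
    exact ⟨τ, hτ, Y, Z, hY.trans hX, hZ.trans hX, h⟩

theorem HasTree.nonempty {v : List (Fin m → A → Prop × Prop)} {X : Set M}
    (h : S.HasTree A F v X) : X.Nonempty := by
  induction v generalizing X with
  | nil => exact h
  | cons i v ih =>
    obtain ⟨τ, hτ, Y, Z, hY, hZ, h, -⟩ := h
    exact (ih h).mono hY

theorem HasTree.image {v : List (Fin m → A → Prop × Prop)} {X : Set M}
    (h : S.HasTree A F v X) {σ : M ≃ M} (hσ : S.IsAuto σ) : S.HasTree A F v (σ '' X) := by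
  induction v generalizing X with
  | nil => exact Set.Nonempty.image σ h
  | cons i v ih =>
    obtain ⟨τ, hτ, Y, Z, hY, hZ, hvY, hvZ, h₁, h₂, h₃, h₄⟩ := h
    refine ⟨σ.symm.trans τ, hσ.symm.trans hτ, σ '' Y, σ '' Z, Set.image_mono hY,
      Set.image_mono hZ, ih hvY, ih hvZ, ?_, ?_, ?_, ?_⟩ <;>
    simpa only [Set.forall_mem_image, Equiv.trans_apply, Equiv.symm_apply_apply]

theorem HasTree.exists_not_rel {v : List (Fin m → A → Prop × Prop)} {X : Set M}
    (h : S.HasTree A F v X) {i : Fin m → A → Prop × Prop} (hi : i ∈ v) :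
    ∃ τ : M ≃ M, S.IsAuto τ ∧ ∃ y ∈ X, ∃ z ∈ X, S.profile A (τ y) = i ∧
      S.profile A (τ z) = i ∧ ¬ F (τ y) (τ z) := by
  induction v generalizing X with
  | nil => simp at hi
  | cons j v ih =>
    obtain ⟨τ, hτ, Y, Z, hY, hZ, hvY, hvZ, h₁, h₂, -, h₄⟩ := h
    rcases List.mem_cons.1 hi with rfl | hi
    · obtain ⟨y, hy⟩ := hvY.nonempty
      obtain ⟨z, hz⟩ := hvZ.nonempty
      exact ⟨τ, hτ, y, hY hy, z, hZ hz, h₁ y hy, h₂ z hz, h₄ y hy z hz⟩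
    · obtain ⟨τ', hτ', y, hy, z, hz, h⟩ := ih hvY hi
      exact ⟨τ', hτ', y, hY hy, z, hY hz, h⟩

theorem HasTree.nodup (hhom : S.Homogeneous)
    (hF : ∀ σ : M ≃ M, S.IsAuto σ → (∀ a ∈ A, σ a = a) → ∀ x y, F x y ↔ F (σ x) (σ y))
    {v : List (Fin m → A → Prop × Prop)} {X : Set M} (h : S.HasTree A F v X) : v.Nodup := by
  induction v generalizing X with
  | nil => exact List.nodup_nil
  | cons i v ih =>
    obtain ⟨τ, hτ, Y, Z, hY, hZ, hvY, hvZ, h₁, h₂, h₃, h₄⟩ := h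
    refine List.nodup_cons.2 ⟨fun hi => ?_, ih hvY⟩
    obtain ⟨τ', hτ', y, hy, z, hz, hyi, hzi, hne⟩ := hvY.exists_not_rel hi
    obtain ⟨σ, hσ, hσA, hσy, hσz⟩ := hhom.exists_isAuto (A := A)
      ((h₁ y hy).trans hyi.symm) ((h₁ z hz).trans hzi.symm)
      ((hτ.pairType_eq y z).trans (hτ'.pairType_eq y z).symm)
    apply hne
    rw [← hσy, ← hσz]
    exact (hF σ hσ hσA _ _).1 (h₃ y hy z hz)

/-- If every finite set has a conjugate in each of infinitely many `F`-classes, then trees of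
arbitrary height exist, even below one colour of a finite colouring. -/
theorem exists_finite_hasTree (hFequiv : Equivalence F) [Nonempty M] {p : ℕ → M}
    (hp : ∀ j k, j ≠ k → ¬ F (p j) (p k))
    (hmove : ∀ X : Set M, X.Finite → ∀ k, ∃ σ : M ≃ M, S.IsAuto σ ∧ ∀ e ∈ X, F (p k) (σ e))
    (n : ℕ) {γ : Type u} [Finite γ] :
    ∃ X : Set M, X.Finite ∧ ∀ g : M → γ, ∃ v : List.Vector (Fin m → A → Prop × Prop) n, ∃ c,
      S.HasTree A F v.1 (X ∩ g ⁻¹' {c}) := by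
  induction n generalizing γ with
  | zero =>
    obtain ⟨a⟩ := ‹Nonempty M›
    exact ⟨{a}, Set.finite_singleton a, fun g => ⟨List.Vector.nil, g a, a, rfl, rfl⟩⟩
  | succ n ih =>
    obtain ⟨X₀, hX₀, h₀⟩ := ih (γ := γ × (Fin m → A → Prop × Prop))
    choose σ hσ hσF using hmove X₀ hX₀
    have : Finite (List.Vector (Fin m → A → Prop × Prop) n) :=
      List.finite_length_eq (Fin m → A → Prop × Prop) n
    obtain ⟨N, ⟨e⟩⟩ := Finite.exists_equiv_fin
      (List.Vector (Fin m → A → Prop × Prop) n × γ × (Fin m → A → Prop × Prop))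
    refine ⟨⋃ k : Fin (N + 1), σ k '' X₀, Set.finite_iUnion fun k => hX₀.image _, fun g => ?_⟩
    choose v c hv using fun k => h₀ fun x => (g (σ k x), S.profile A (σ k x))
    obtain ⟨j, k, hjk, hjk'⟩ := Fintype.exists_ne_map_eq_of_card_lt
      (fun k : Fin (N + 1) => e (v k, c k)) (by simp)
    obtain ⟨hvv, hcc⟩ := Prod.mk.inj (e.injective hjk')
    have hmem : ∀ l, c l = c k → ∀ x ∈ X₀ ∩ (fun x => (g (σ l x), S.profile A (σ l x))) ⁻¹' {c l},
        g (σ l x) = (c k).1 ∧ S.profile A (σ l x) = (c k).2 := by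
      rintro l hl x ⟨-, hx⟩
      rw [hl] at hx
      exact Prod.ext_iff.1 hx
    have hsub : ∀ l : Fin (N + 1), c l = c k →
        σ l '' (X₀ ∩ (fun x => (g (σ l x), S.profile A (σ l x))) ⁻¹' {c l}) ⊆
          (⋃ k : Fin (N + 1), σ k '' X₀) ∩ g ⁻¹' {(c k).1} := by
      rintro l hl _ ⟨x, hx, rfl⟩
      exact ⟨Set.mem_iUnion.2 ⟨l, x, hx.1, rfl⟩, (hmem l hl x hx).1⟩
    refine ⟨List.Vector.cons (c k).2 (v k), (c k).1, ?_⟩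
    change S.HasTree A F ((c k).2 :: (v k).1) _
    refine ⟨Equiv.refl M, IsAuto.refl, _, _, hsub j hcc, hsub k rfl, ?_, (hv k).image (hσ k),
      ?_, ?_, ?_, ?_⟩
    · rw [← hvv]
      exact (hv j).image (hσ j)
    · rintro _ ⟨x, hx, rfl⟩
      exact (hmem j hcc x hx).2
    · rintro _ ⟨x, hx, rfl⟩
      exact (hmem k rfl x hx).2
    · rintro _ ⟨x, hx, rfl⟩ _ ⟨y, hy, rfl⟩
      exact hFequiv.trans (hFequiv.symm (hσF j x hx.1)) (hσF j y hy.1)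
    · rintro _ ⟨x, hx, rfl⟩ _ ⟨y, hy, rfl⟩ hxy
      exact hp j k (fun h => hjk (Fin.ext h))
        (hFequiv.trans (hσF j x hx.1) (hFequiv.trans hxy (hFequiv.symm (hσF k y hy.1))))

end Tree

end BinStruct

/-- If `M` is a countably infinite homogeneous binary structure with a distinguished linear
order `≤`, and `E` is the coarsest proper ∅-definable `≤`-convex equivalence relation, then
`M/E` has topological rank 1: there is no finite parameter set `A` and `A`-definable `≤`-convex
equivalence relation, coarser than `E`, with infinitely many classes each containing infinitely
many `E`-classes. -/
theorem quotient_topological_rank_one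
    {m : ℕ} {M : Type*} [Countable M] [Infinite M] (S : BinStruct m M)
    (hhom : S.Homogeneous)
    (E : M → M → Prop) (hEdef : S.Definable E) (hEequiv : Equivalence E)
    (hEconv : S.Convex E) (hEproper : ¬ ∀ x y, E x y)
    (hEcoarsest : ∀ F : M → M → Prop, S.Definable F → Equivalence F → S.Convex F →
      (¬ ∀ x y, F x y) → ∀ x y, F x y → E x y) :
    ¬ ∃ (A : Finset M) (F : M → M → Prop),
        Equivalence F ∧
        (∀ σ : M ≃ M, S.IsAuto σ → (∀ a ∈ A, σ a = a) → ∀ x y, F x y ↔ F (σ x) (σ y)) ∧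
        (∀ x y, E x y → F x y) ∧
        S.Convex F ∧
        {s : Set M | (∃ x, s = {y | F x y}) ∧
          {t : Set M | ∃ y ∈ s, t = {z | E y z}}.Infinite}.Infinite := by
  rintro ⟨A, F, hF, hFinv, hEF, hFconv, hinf⟩
  let s := hinf.natEmbedding
  choose p hp using fun k => (s k).2.1
  have hpF : ∀ j k, j ≠ k → ¬ F (p j) (p k) := by
    intro j k hjk h
    refine hjk (s.injective (Subtype.ext ?_))
    rw [hp j, hp k]
    ext y
    exact ⟨hF.trans (hF.symm h), hF.trans h⟩
  have hpE : ∀ j k, j ≠ k → ¬ E (p j) (p k) := fun j k hjk h => hpF j k hjk (hEF _ _ h)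
  have hmove : ∀ X : Set M, X.Finite → ∀ k,
      ∃ σ : M ≃ M, S.IsAuto σ ∧ ∀ e ∈ X, F (p k) (σ e) := by
    intro X hX k
    obtain ⟨x, y, hx, hy, hxy, hne⟩ : ∃ x y, F (p k) x ∧ F (p k) y ∧ S.le x y ∧ ¬ E x y := by
      obtain ⟨_, ⟨x, hx, rfl⟩, _, ⟨y, hy, rfl⟩, hne⟩ := (s k).2.2.nontrivial
      rw [hp k] at hx hy
      have hxy : ¬ E x y := fun h => hne (by
        ext z
        exact ⟨hEequiv.trans (hEequiv.symm h), hEequiv.trans h⟩)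
      rcases S.total x y with h | h
      · exact ⟨x, y, hx, hy, h, hxy⟩
      · exact ⟨y, x, hy, hx, h, fun h' => hxy (hEequiv.symm h')⟩
    obtain ⟨σ, hσ, h⟩ := BinStruct.exists_isAuto_subset_interval hhom hEequiv hEcoarsest
      (hpE 0 1 (by simp)) (hpE 1 2 (by simp)) (hpE 0 2 (by simp)) hxy hne hX
    exact ⟨σ, hσ, fun e he => hF.trans hx
      (hFconv _ _ _ (h e he).1 (h e he).2 (hF.trans (hF.symm hx) hy))⟩
  have := Fintype.ofFinite (Fin m → A → Prop × Prop)
  obtain ⟨X, -, hX⟩ := BinStruct.exists_finite_hasTree (S := S) (A := A) hF hpF hmove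
    (Fintype.card (Fin m → A → Prop × Prop) + 1) (γ := PUnit)
  obtain ⟨v, _, hv⟩ := hX fun _ => PUnit.unit
  have hlen := (hv.nodup hhom hFinv).length_le_card
  rw [v.2] at hlen
  omega
end
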